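/- arXiv:math/0612237 — 3 statements merged into one kernel-verified Lean document; each statement's English description precedes it below -/
import Mathlib

section
/- Assume the null controllability property (C). Let y₀ ∈ H, let S ⊆ H be nonempty, let U ⊆ H be closed, bounded and nonempty, and let T* > 0 together with u* ∈ U_ad be optimal. Then u*(t) belongs to the topological frontier ∂U of U for almost every t ∈ [0, T*]. (Bang-bang principle for time optimal controls.) -/
open MeasureTheory

lemma aux_cantor {X : Type*} [TopologicalSpace X] [PolishSpace X] [MeasurableSpace X]
    [BorelSpace X] (μ : Measure X) [SigmaFinite μ] (h : X → ℝ) (hc : Continuous h)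
    (A : Set X) (hAm : MeasurableSet A) (hA : μ A ≠ 0)
    (hf : ∀ x ∈ A, μ (A ∩ h ⁻¹' {h x}) = 0) :
    ∃ i : (ℕ → Bool) → ℝ, Set.range i ⊆ h '' A ∧ Function.Injective i := by
  obtain ⟨K, hKA, hK, hpos⟩ := hAm.exists_lt_isCompact (μ := μ) (pos_iff_ne_zero.2 hA)
  have hKc : IsClosed (h '' K) := (hK.image hc).isClosed
  have hunc : ¬ (h '' K).Countable := by
    intro hcount
    have hsub : K ⊆ ⋃ r ∈ h '' K, (A ∩ h ⁻¹' {r}) := by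
      intro x hx
      simp only [Set.mem_iUnion]
      exact ⟨h x, ⟨x, hx, rfl⟩, hKA hx, rfl⟩
    have : μ (⋃ r ∈ h '' K, (A ∩ h ⁻¹' {r})) = 0 := by
      rw [measure_biUnion_null_iff hcount]
      rintro r ⟨x, hx, rfl⟩
      exact hf x (hKA hx)
    exact hpos.ne' (measure_mono_null hsub this)
  obtain ⟨i, hi, -, hinj⟩ := hKc.exists_nat_bool_injection_of_not_countable hunc
  exact ⟨i, hi.trans (Set.image_mono hKA), hinj⟩

lemma aux_card (φ : Set (ℕ → Bool) → Set ℝ) (hφ : ∀ S, MeasurableSet (φ S))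
    (hinj : Function.Injective φ) : False := by
  obtain ⟨b, hb, hgen⟩ := MeasurableSpace.CountablyGenerated.isCountablyGenerated (α := ℝ)
  have h1 : Cardinal.mk {t : Set ℝ | MeasurableSet t} ≤ Cardinal.continuum := by
    rw [hgen]
    exact MeasurableSpace.cardinal_measurableSet_le_continuum
      (hb.le_aleph0.trans Cardinal.aleph0_le_continuum)
  have h2 : Cardinal.mk (Set (ℕ → Bool)) ≤ Cardinal.mk {t : Set ℝ | MeasurableSet t} :=
    Cardinal.mk_le_of_injective (f := fun S => ⟨φ S, hφ S⟩) (fun S T h => hinj (by simpa using h))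
  have h3 := h2.trans h1
  rw [Cardinal.mk_set] at h3
  have h4 : Cardinal.mk (ℕ → Bool) = Cardinal.continuum := by simp
  rw [h4] at h3
  exact absurd h3 (not_le.2 (Cardinal.cantor _))

lemma aux_discrete {α : Type*} (g : ℝ → α) (hg : ∀ Z : Set α, MeasurableSet (g ⁻¹' Z)) :
    ∃ C : Set α, C.Countable ∧ ∀ᵐ t ∂(volume : Measure ℝ), g t ∈ C := by
  classical
  refine ⟨{d | 0 < (volume : Measure ℝ) (g ⁻¹' {d})},
    Measure.countable_meas_pos_of_disjoint_iUnion (fun d => hg {d})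
      (fun a b hab => Disjoint.preimage g (Set.disjoint_singleton.2 hab)), ?_⟩
  by_contra hne
  set C := {d | 0 < (volume : Measure ℝ) (g ⁻¹' {d})} with hC
  set A : Set ℝ := g ⁻¹' Cᶜ with hAdef
  have hA : (volume : Measure ℝ) A ≠ 0 := hne
  let h : ℝ → ℝ := fun t => Function.invFun g (g t)
  have hgh : ∀ t, g (h t) = g t := fun t => Function.invFun_eq ⟨t, rfl⟩
  have hhg : ∀ s t, g s = g t → h s = h t := fun s t e => by simp only [h, e]
  have hm : Measurable h := fun Z _ => hg (Function.invFun g ⁻¹' Z)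
  have hP : PolishSpace ℝ := inferInstance
  have hBo := BorelSpace.measurable_eq (α := ℝ)
  have hσ : SigmaFinite (volume : Measure ℝ) := inferInstance
  obtain ⟨t', hle, hcont, hpol⟩ := hm.exists_continuous
  have hbor : @BorelSpace ℝ t' _ := by
    refine @BorelSpace.mk ℝ t' _ ?_
    rw [borel_eq_borel_of_le hpol hP hle]
    exact hBo
  obtain ⟨i, hi, hinj⟩ := @aux_cantor ℝ t' hpol _ hbor volume hσ h hcont A (hg _) hA (by
    intro x hx
    refine measure_mono_null (t := g ⁻¹' {g x}) ?_ ?_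
    · rintro y ⟨-, hy⟩
      have hy' : h y = h x := hy
      show g y = g x
      rw [← hgh y, hy', hgh x]
    · have : ¬ 0 < (volume : Measure ℝ) (g ⁻¹' {g x}) := hx
      simpa using this)
  have hfix : ∀ s, h (i s) = i s := by
    intro s
    obtain ⟨x, -, hx⟩ := hi ⟨s, rfl⟩
    rw [← hx]
    exact hhg _ _ (hgh x)
  refine aux_card (fun S => g ⁻¹' (g '' (i '' S))) (fun S => hg _) ?_
  have key : ∀ S s, i s ∈ g ⁻¹' (g '' (i '' S)) ↔ s ∈ S := by
    intro S s
    constructor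
    · rintro ⟨_, ⟨s', hs', rfl⟩, e⟩
      have := hhg _ _ e
      rw [hfix, hfix] at this
      exact hinj this ▸ hs'
    · intro hs
      exact ⟨_, ⟨s, hs, rfl⟩, rfl⟩
  intro S T hST
  ext s
  have hST' : g ⁻¹' (g '' (i '' S)) = g ⁻¹' (g '' (i '' T)) := hST
  rw [← key S, ← key T, hST']

/-- A discretisation all of whose preimages are Borel. -/
lemma aux_retract {X : Type*} [MetricSpace X] [MeasurableSpace X] [BorelSpace X]
    (ε : ℝ) (hε : 0 < ε) :
    ∃ p : X → X, (∀ x, dist x (p x) < ε) ∧ ∀ Z : Set X, MeasurableSet (p ⁻¹' Z) := by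
  classical
  let r : X → X → Prop := WellOrderingRel
  have wf : WellFounded r := WellOrderingRel.isWellOrder.wf
  have hne : ∀ x : X, (Metric.ball x ε).Nonempty := fun x => ⟨x, Metric.mem_ball_self hε⟩
  let p : X → X := fun x => wf.min (Metric.ball x ε) (hne x)
  have hp : ∀ x, p x ∈ Metric.ball x ε := fun x => wf.min_mem _ _
  have hmin : ∀ x d, dist x d < ε → ¬ r d (p x) := fun x d hd =>
    wf.not_lt_min _ (by rwa [Metric.mem_ball, dist_comm])
  refine ⟨p, fun x => by rw [dist_comm]; exact hp x, fun Z => ?_⟩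
  let F : ℕ → Set X := fun n => {x | p x ∈ Z ∧ dist x (p x) ≤ ε - 1 / ((n : ℝ) + 1)}
  have hF : ∀ n, IsClosed (F n) := by
    intro n
    have hn : (0 : ℝ) < 1 / ((n : ℝ) + 1) := by positivity
    rw [← closure_subset_iff_isClosed]
    intro x hx
    have hclose : ∀ a ∈ F n, ∀ b ∈ F n, dist a b < 1 / ((n : ℝ) + 1) → p a = p b := by
      intro a ha b hb hab
      have h1 : ¬ r (p b) (p a) := hmin a _ (by
        have := dist_triangle a b (p b); linarith [hb.2])
      have h2 : ¬ r (p a) (p b) := hmin b _ (by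
        have := dist_triangle b a (p a); rw [dist_comm b a] at this; linarith [ha.2])
      rcases WellOrderingRel.isWellOrder.trichotomous (p a) (p b) h2 h1 with h
      exact h
    rw [Metric.mem_closure_iff] at hx
    obtain ⟨a, ha, hxa⟩ := hx (1 / ((n : ℝ) + 1) / 2) (by positivity)
    -- points of `F n` close to `x` all have the same value `p a`
    have hsame : ∀ b ∈ F n, dist x b < 1 / ((n : ℝ) + 1) / 2 → p b = p a := fun b hb hxb =>
      hclose b hb a ha (by
        have := dist_triangle b x a; rw [dist_comm b x] at this; linarith)
    have hdist : dist x (p a) ≤ ε - 1 / ((n : ℝ) + 1) := by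
      refine le_of_forall_pos_le_add fun η hη => ?_
      obtain ⟨b, hb, hxb⟩ := hx (min η (1 / ((n : ℝ) + 1) / 2)) (by positivity)
      have h1 := hsame b hb (hxb.trans_le (min_le_right _ _))
      have h2 := dist_triangle x b (p b)
      have h3 := hxb.trans_le (min_le_left _ _)
      rw [← h1]
      linarith [hb.2]
    have hpx : p x = p a := by
      have h2 : ¬ r (p a) (p x) := hmin x _ (by linarith)
      have h1 : ¬ r (p x) (p a) := by
        have hlt : dist x (p x) < ε := by rw [dist_comm]; exact hp x
        obtain ⟨b, hb, hxb⟩ := hx (min (ε - dist x (p x)) (1 / ((n : ℝ) + 1) / 2))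
          (lt_min (by linarith) (by positivity))
        rw [← hsame b hb (hxb.trans_le (min_le_right _ _))]
        refine hmin b _ ?_
        have h2 := dist_triangle b x (p x)
        have h3 := hxb.trans_le (min_le_left _ _)
        rw [dist_comm b x] at h2
        linarith
      exact WellOrderingRel.isWellOrder.trichotomous _ _ h1 h2
    exact ⟨hpx ▸ ha.1, hpx ▸ hdist⟩
  have hU : p ⁻¹' Z = ⋃ n, F n := by
    ext x
    simp only [Set.mem_preimage, Set.mem_iUnion]
    constructor
    · intro hx
      have hlt : dist x (p x) < ε := by rw [dist_comm]; exact hp x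
      obtain ⟨n, hn⟩ := exists_nat_one_div_lt (sub_pos.2 hlt)
      exact ⟨n, hx, by linarith⟩
    · rintro ⟨n, hx, -⟩
      exact hx
  rw [hU]
  exact MeasurableSet.iUnion fun n => (hF n).measurableSet

/-- Every Borel function from the line to a metric space is a.e. strongly measurable. -/
lemma aux_aesm {X : Type*} [MetricSpace X] [MeasurableSpace X] [BorelSpace X]
    (f : ℝ → X) (hf : Measurable f) : AEStronglyMeasurable f (volume : Measure ℝ) := by
  rw [aestronglyMeasurable_iff_aemeasurable_separable]
  refine ⟨hf.aemeasurable, ?_⟩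
  have : ∀ n : ℕ, ∃ C : Set X, C.Countable ∧
      ∀ᵐ t ∂(volume : Measure ℝ), ∃ c ∈ C, dist (f t) c < 1 / ((n : ℝ) + 1) := by
    intro n
    obtain ⟨p, hp, hpm⟩ := aux_retract (X := X) (1 / ((n : ℝ) + 1)) (by positivity)
    obtain ⟨C, hC, hae⟩ := aux_discrete (fun t => p (f t)) (fun Z => hf (hpm Z))
    exact ⟨C, hC, hae.mono fun t ht => ⟨_, ht, hp _⟩⟩
  choose C hC hae using this
  refine ⟨closure (⋃ n, C n), (Set.countable_iUnion hC).isSeparable.closure, ?_⟩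
  filter_upwards [ae_all_iff.2 hae] with t ht
  rw [Metric.mem_closure_iff]
  intro ε hε
  obtain ⟨n, hn⟩ := exists_nat_one_div_lt hε
  obtain ⟨c, hc, hd⟩ := ht n
  exact ⟨c, Set.mem_iUnion.2 ⟨n, hc⟩, hd.trans hn⟩

section aux
variable {H : Type*} [NormedAddCommGroup H] [InnerProductSpace ℝ H] [CompleteSpace H]

lemma aux_joint (G : ℝ → H →L[ℝ] H)
    (hGcontr : ∀ t : ℝ, 0 ≤ t → ∀ x : H, ‖G t x‖ ≤ ‖x‖)
    (hGcont : ∀ x : H, ContinuousOn (fun t => G t x) (Set.Ici (0 : ℝ))) :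
    Continuous (fun q : ℝ × H => G (max q.1 0) q.2) := by
  refine continuous_prod_of_continuous_lipschitzWith'
    (fun q : ℝ × H => G (max q.1 0) q.2) 1 ?_ ?_
  · intro t
    refine LipschitzWith.of_dist_le_mul fun x y => ?_
    simp only [dist_eq_norm, NNReal.coe_one, one_mul, ← map_sub]
    exact hGcontr _ (le_max_right _ _) _
  · intro x
    exact (hGcont x).comp_continuous (f := fun t : ℝ => max t 0) (by fun_prop)
      (fun t => Set.mem_Ici.2 (le_max_right _ _))

lemma aux_int (G : ℝ → H →L[ℝ] H)
    (hGcontr : ∀ t : ℝ, 0 ≤ t → ∀ x : H, ‖G t x‖ ≤ ‖x‖)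
    (hGcont : ∀ x : H, ContinuousOn (fun t => G t x) (Set.Ici (0 : ℝ)))
    (w : ℝ → H) (hw : AEStronglyMeasurable w (volume : Measure ℝ)) (M : ℝ)
    (hM : ∀ᵐ t ∂((volume : Measure ℝ).restrict (Set.Ici (0 : ℝ))), ‖w t‖ ≤ M) (t : ℝ) :
    IntegrableOn (fun s => G (t - s) (w s)) (Set.Ioc 0 t) volume ∧
      ∀ᵐ s ∂((volume : Measure ℝ).restrict (Set.Ioc (0 : ℝ) t)), ‖G (t - s) (w s)‖ ≤ M := by
  have hb : ∀ᵐ s ∂((volume : Measure ℝ).restrict (Set.Ioc (0 : ℝ) t)), ‖G (t - s) (w s)‖ ≤ M := by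
    have h1 := ae_restrict_of_ae_restrict_of_subset
      (Set.Ioc_subset_Icc_self.trans (fun s (hs : s ∈ Set.Icc 0 t) => (hs.1 : s ∈ Set.Ici (0 : ℝ)))) hM
    filter_upwards [h1, ae_restrict_mem measurableSet_Ioc] with s hs hst
    exact (hGcontr _ (by linarith [hst.2]) _).trans hs
  refine ⟨?_, hb⟩
  have hmeas : AEStronglyMeasurable (fun s => G (t - s) (w s))
      ((volume : Measure ℝ).restrict (Set.Ioc (0 : ℝ) t)) := by
    have h1 : AEStronglyMeasurable (fun s => ((t - s : ℝ), w s)) (volume : Measure ℝ) :=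
      (by fun_prop : Continuous fun s : ℝ => t - s).aestronglyMeasurable.prodMk hw
    have h2 := ((aux_joint G hGcontr hGcont).comp_aestronglyMeasurable h1).mono_measure
      (Measure.restrict_le_self (s := Set.Ioc (0 : ℝ) t))
    refine h2.congr ?_
    filter_upwards [ae_restrict_mem measurableSet_Ioc] with s hs
    rw [max_eq_left (by linarith [hs.2])]
  exact Integrable.of_bound hmeas M hb

lemma aux_split (G : ℝ → H →L[ℝ] H)
    (hGadd : ∀ s t : ℝ, 0 ≤ s → 0 ≤ t → G (s + t) = (G s).comp (G t))
    (hGcontr : ∀ t : ℝ, 0 ≤ t → ∀ x : H, ‖G t x‖ ≤ ‖x‖)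
    (hGcont : ∀ x : H, ContinuousOn (fun t => G t x) (Set.Ici (0 : ℝ)))
    (w : ℝ → H) (hw : AEStronglyMeasurable w (volume : Measure ℝ)) (M : ℝ)
    (hM : ∀ᵐ t ∂((volume : Measure ℝ).restrict (Set.Ici (0 : ℝ))), ‖w t‖ ≤ M) (T δ : ℝ)
    (hδ : 0 ≤ δ) (hδT : δ ≤ T) :
    ∫ s in Set.Ioc (0 : ℝ) T, G (T - s) (w s) =
      G (T - δ) (∫ s in Set.Ioc (0 : ℝ) δ, G (δ - s) (w s)) +
        ∫ s in Set.Ioc (0 : ℝ) (T - δ), G (T - δ - s) (w (s + δ)) := by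
  have hI := (aux_int G hGcontr hGcont w hw M hM T).1
  have hI' := (aux_int G hGcontr hGcont w hw M hM δ).1
  rw [← Set.Ioc_union_Ioc_eq_Ioc hδ hδT, setIntegral_union
    (Set.Ioc_disjoint_Ioc_of_le le_rfl) measurableSet_Ioc
    (hI.mono_set (Set.Ioc_subset_Ioc_right hδT)) (hI.mono_set (Set.Ioc_subset_Ioc_left hδ))]
  congr 1
  · rw [← ContinuousLinearMap.integral_comp_comm _ hI']
    refine setIntegral_congr_fun measurableSet_Ioc fun s hs => ?_
    have := hGadd (T - δ) (δ - s) (by linarith) (by linarith [hs.2])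
    rw [show T - δ + (δ - s) = T - s by ring] at this
    simp only [this, ContinuousLinearMap.comp_apply]
  · rw [← intervalIntegral.integral_of_le hδT, ← intervalIntegral.integral_of_le (by linarith)]
    have := intervalIntegral.integral_comp_add_right (a := 0) (b := T - δ)
      (fun s => G (T - s) (w s)) δ
    rw [zero_add, sub_add_cancel] at this
    rw [← this]
    refine intervalIntegral.integral_congr fun s _ => ?_
    simp only [show T - (s + δ) = T - δ - s by ring]

end aux

/-- Bang-bang principle (Theorem 3.1, first part): under the null controllability
property (C), every time optimal control takes values on the boundary of the
control set U for almost every t ∈ [0, T*]. -/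
theorem bang_bang_principle
    {H : Type*} [NormedAddCommGroup H] [InnerProductSpace ℝ H] [CompleteSpace H]
    [MeasurableSpace H] [BorelSpace H]
    (G : ℝ → H →L[ℝ] H)
    (hG0 : G 0 = ContinuousLinearMap.id ℝ H)
    (hGadd : ∀ s t : ℝ, 0 ≤ s → 0 ≤ t → G (s + t) = (G s).comp (G t))
    (hGcontr : ∀ t : ℝ, 0 ≤ t → ∀ x : H, ‖G t x‖ ≤ ‖x‖)
    (hGcont : ∀ x : H, ContinuousOn (fun t => G t x) (Set.Ici (0 : ℝ)))
    (B : H →L[ℝ] H) (hB : ∀ x, ‖B x‖ ≤ ‖x‖)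
    -- the null controllability property (C):
    (hC : ∀ T : ℝ, 0 < T → ∀ E : Set ℝ, MeasurableSet E → E ⊆ Set.Icc 0 T →
      0 < volume E →
      ∃ δ₀ L : ℝ, 0 < δ₀ ∧ δ₀ < T ∧ 0 < L ∧
        ∀ δ : ℝ, 0 ≤ δ → δ ≤ δ₀ → ∀ z₀ : H,
          ∃ u : ℝ → H, Measurable u ∧
            (∀ᵐ t ∂(volume.restrict (Set.Ici (0 : ℝ))), ‖u t‖ ^ 2 ≤ L * ‖z₀‖ ^ 2) ∧
            G (T - δ) z₀ + ∫ s in Set.Ioc (0 : ℝ) (T - δ),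
                G (T - δ - s)
                  ((Set.indicator {t : ℝ | t + δ ∈ E} (fun _ => (1 : ℝ)) s) • B (u s)) = 0)
    (y₀ : H) (S : Set H) (hS : S.Nonempty)
    (U : Set H) (hU_closed : IsClosed U) (hU_bdd : Bornology.IsBounded U)
    (hU_ne : U.Nonempty)
    (Tstar : ℝ) (hTstar : 0 < Tstar)
    (ustar : ℝ → H) (hustar_meas : Measurable ustar)
    (hustar_ad : ∀ᵐ t ∂(volume.restrict (Set.Ici (0 : ℝ))), ustar t ∈ U)
    -- optimality of (T*, u*):
    (hreach : G Tstar y₀ + ∫ s in Set.Ioc (0 : ℝ) Tstar, G (Tstar - s) (B (ustar s)) ∈ S)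
    (hopt : ∀ u : ℝ → H, Measurable u →
      (∀ᵐ t ∂(volume.restrict (Set.Ici (0 : ℝ))), u t ∈ U) →
      ∀ t : ℝ, 0 ≤ t → t < Tstar →
        G t y₀ + ∫ s in Set.Ioc (0 : ℝ) t, G (t - s) (B (u s)) ∉ S) :
    ∀ᵐ t ∂(volume.restrict (Set.Icc (0 : ℝ) Tstar)), ustar t ∈ frontier U := by
  have hsm : AEStronglyMeasurable ustar (volume : Measure ℝ) := aux_aesm _ hustar_meas
  obtain ⟨M, hM⟩ := hU_bdd.exists_norm_le
  -- the shrunken sets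
  let V : ℝ → Set H := fun ε => {x | Metric.ball x ε ⊆ U}
  have hV : ∀ ε, IsClosed (V ε) := by
    intro ε
    have : V ε = ⋂ y ∈ Uᶜ, {x | ε ≤ dist y x} := by
      ext x
      simp only [V, Set.mem_ofPred_eq, Set.mem_iInter, Set.subset_def, Metric.mem_ball,
        Set.mem_compl_iff]
      exact forall_congr' fun y => by rw [← not_imp_not, not_lt]
    rw [this]
    exact isClosed_biInter fun y _ => isClosed_le continuous_const (by fun_prop)
  have key : ∀ ε : ℝ, 0 < ε →
      (volume : Measure ℝ) (Set.Icc 0 Tstar ∩ ustar ⁻¹' (V ε)) = 0 := by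
    intro ε hε
    by_contra hpos
    set E := Set.Icc 0 Tstar ∩ ustar ⁻¹' (V ε) with hE
    have hEm : MeasurableSet E := measurableSet_Icc.inter (hustar_meas (hV ε).measurableSet)
    obtain ⟨δ₀, L, hδ₀, hδ₀T, hL, hctrl⟩ :=
      hC Tstar hTstar E hEm Set.inter_subset_left (pos_iff_ne_zero.2 hpos)
    have hBu : AEStronglyMeasurable (fun s => B (ustar s)) (volume : Measure ℝ) :=
      B.continuous.comp_aestronglyMeasurable hsm
    have hBM : ∀ᵐ t ∂((volume : Measure ℝ).restrict (Set.Ici (0 : ℝ))), ‖B (ustar t)‖ ≤ M :=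
      hustar_ad.mono fun t ht => (hB _).trans (hM _ ht)
    -- choose δ
    obtain ⟨δ, hδpos, hδle, hδsmall⟩ : ∃ δ : ℝ, 0 < δ ∧ δ ≤ δ₀ ∧
        L * ‖y₀ - (G δ y₀ + ∫ s in Set.Ioc (0 : ℝ) δ, G (δ - s) (B (ustar s)))‖ ^ 2 < ε ^ 2 := by
      have hlim : Filter.Tendsto (fun δ : ℝ => L * (‖y₀ - G δ y₀‖ + M * δ) ^ 2)
          (nhdsWithin 0 (Set.Ioi 0)) (nhds 0) := by
        have h1 : Filter.Tendsto (fun δ : ℝ => G δ y₀) (nhdsWithin 0 (Set.Ioi 0)) (nhds y₀) := by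
          have := ((hGcont y₀) 0 Set.self_mem_Ici).mono_left
            (nhdsWithin_mono 0 Set.Ioi_subset_Ici_self)
          simpa [hG0] using this
        have h2 : Filter.Tendsto (fun δ : ℝ => δ) (nhdsWithin 0 (Set.Ioi 0)) (nhds 0) :=
          tendsto_nhdsWithin_of_tendsto_nhds Filter.tendsto_id
        have h3 := ((((tendsto_const_nhds (x := y₀)).sub h1).norm.add
          (h2.const_mul M)).pow 2).const_mul L
        simpa using h3
      have hev := hlim.eventually (gt_mem_nhds (show (0 : ℝ) < ε ^ 2 by positivity))
      obtain ⟨δ, h1, h2, h3⟩ := (hev.and ((Ioc_mem_nhdsGT hδ₀ :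
        Set.Ioc 0 δ₀ ∈ nhdsWithin (0 : ℝ) (Set.Ioi 0)))).exists
      refine ⟨δ, h2, h3, lt_of_le_of_lt ?_ h1⟩
      have hn : ‖∫ s in Set.Ioc (0 : ℝ) δ, G (δ - s) (B (ustar s))‖ ≤ M * δ := by
        have := norm_setIntegral_le_of_norm_le_const_ae (μ := (volume : Measure ℝ))
          (s := Set.Ioc (0 : ℝ) δ) (by simp) (aux_int G hGcontr hGcont _ hBu M hBM δ).2
        simpa [Measure.real, h2.le] using this
      have hn2 : ‖y₀ - (G δ y₀ + ∫ s in Set.Ioc (0 : ℝ) δ, G (δ - s) (B (ustar s)))‖ ≤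
          ‖y₀ - G δ y₀‖ + M * δ := by
        rw [← sub_sub]
        exact (norm_sub_le _ _).trans (by linarith)
      gcongr
    set z₀ := y₀ - (G δ y₀ + ∫ s in Set.Ioc (0 : ℝ) δ, G (δ - s) (B (ustar s))) with hz₀
    obtain ⟨u, hum, hub, hueq⟩ := hctrl δ hδpos.le hδle z₀
    have husm : AEStronglyMeasurable u (volume : Measure ℝ) := aux_aesm _ hum
    set Eδ : Set ℝ := {t : ℝ | t + δ ∈ E} with hEδ
    have hEδm : MeasurableSet Eδ := (measurable_add_const δ) hEm
    have hqmp : Measure.QuasiMeasurePreserving (fun s : ℝ => s + δ) volume volume :=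
      (measurePreserving_add_right volume δ).quasiMeasurePreserving
    have hsh : AEStronglyMeasurable (fun s => ustar (s + δ)) (volume : Measure ℝ) :=
      hsm.comp_quasiMeasurePreserving hqmp
    have hshU : ∀ᵐ t ∂((volume : Measure ℝ).restrict (Set.Ici (0 : ℝ))), ustar (t + δ) ∈ U := by
      have h1 := hqmp.ae ((ae_restrict_iff' measurableSet_Ici).1 hustar_ad)
      rw [ae_restrict_iff' measurableSet_Ici]
      filter_upwards [h1] with t ht h0
      exact ht (by simp only [Set.mem_Ici] at h0 ⊢; linarith)
    have hχm : AEStronglyMeasurable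
        (fun s => Set.indicator Eδ (fun _ => (1 : ℝ)) s • u s) (volume : Measure ℝ) :=
      (stronglyMeasurable_const.indicator hEδm).aestronglyMeasurable.smul husm
    have hv0 := hsh.add hχm
    have hvv : ∀ᵐ s ∂(volume : Measure ℝ), hv0.mk _ s =
        ustar (s + δ) + Set.indicator Eδ (fun _ => (1 : ℝ)) s • u s := hv0.ae_eq_mk.symm
    have hu_lt : ∀ᵐ t ∂((volume : Measure ℝ).restrict (Set.Ici (0 : ℝ))), ‖u t‖ < ε := by
      filter_upwards [hub] with t ht
      exact lt_of_pow_lt_pow_left₀ 2 hε.le (lt_of_le_of_lt ht hδsmall)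
    refine hopt (hv0.mk _) hv0.stronglyMeasurable_mk.measurable ?_ (Tstar - δ)
      (by linarith) (by linarith) ?_
    · filter_upwards [hu_lt, hshU, ae_restrict_of_ae hvv] with t h1 h2 h3
      rw [h3]
      by_cases ht : t ∈ Eδ
      · have : Metric.ball (ustar (t + δ)) ε ⊆ U := ht.2
        apply this
        simpa [ht] using h1
      · simpa [ht] using h2
    · have hint1 := (aux_int G hGcontr hGcont (fun s => B (ustar (s + δ)))
        (B.continuous.comp_aestronglyMeasurable hsh) M
        (hshU.mono fun t ht => (hB _).trans (hM _ ht)) (Tstar - δ)).1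
      have hint2 := (aux_int G hGcontr hGcont
        (fun s => Set.indicator Eδ (fun _ => (1 : ℝ)) s • B (u s))
        (by simpa using B.continuous.comp_aestronglyMeasurable hχm) ε
        (hu_lt.mono fun t ht => by
          by_cases h : t ∈ Eδ
          · simpa [h] using (hB _).trans ht.le
          · simpa [h] using hε.le) (Tstar - δ)).1
      have hsum : ∫ s in Set.Ioc (0 : ℝ) (Tstar - δ), G (Tstar - δ - s) (B (hv0.mk _ s)) =
          (∫ s in Set.Ioc (0 : ℝ) (Tstar - δ), G (Tstar - δ - s) (B (ustar (s + δ)))) +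
          ∫ s in Set.Ioc (0 : ℝ) (Tstar - δ), G (Tstar - δ - s)
            (Set.indicator Eδ (fun _ => (1 : ℝ)) s • B (u s)) := by
        rw [← integral_add hint1 hint2]
        refine integral_congr_ae ?_
        filter_upwards [ae_restrict_of_ae hvv] with s hs
        rw [hs, map_add, map_add, map_smul]
      have hsplit := aux_split G hGadd hGcontr hGcont _ hBu M hBM Tstar δ hδpos.le (by linarith)
      have hGT := hGadd (Tstar - δ) δ (by linarith) hδpos.le
      rw [sub_add_cancel] at hGT
      have heq := eq_neg_of_add_eq_zero_right hueq
      convert hreach using 1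
      rw [hsum, hsplit, heq, hGT, hz₀]
      simp only [map_sub, map_add, ContinuousLinearMap.comp_apply]
      abel
  have hall : ∀ᵐ t ∂(volume : Measure ℝ), ∀ n : ℕ,
      t ∉ Set.Icc 0 Tstar ∩ ustar ⁻¹' (V (1 / ((n : ℝ) + 1))) :=
    ae_all_iff.2 fun n => measure_eq_zero_iff_ae_notMem.1 (key _ (by positivity))
  have had := ae_restrict_of_ae_restrict_of_subset
    (fun s (hs : s ∈ Set.Icc 0 Tstar) => (hs.1 : s ∈ Set.Ici (0 : ℝ))) hustar_ad
  filter_upwards [had, ae_restrict_of_ae hall, ae_restrict_mem measurableSet_Icc] with t h1 h2 h3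
  rw [hU_closed.frontier_eq]
  refine ⟨h1, fun hint => ?_⟩
  obtain ⟨r, hr, hball⟩ := Metric.isOpen_iff.1 isOpen_interior _ hint
  obtain ⟨n, hn⟩ := exists_nat_one_div_lt hr
  exact h2 n ⟨h3, ((Metric.ball_subset_ball hn.le).trans hball).trans interior_subset⟩
end

section
/- Assume the null controllability property (C), that B is idempotent (B∘B = B), and that B maps U into U (B(v) ∈ U for every v ∈ U). Let y₀ ∈ H, let S ⊆ H be nonempty, let U ⊆ H be closed, bounded and nonempty, and let T* > 0 together with u* ∈ U_ad be optimal. Then B(u*(t)) belongs to the topological frontier ∂U of U for almost every t ∈ [0, T*]. -/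
open MeasureTheory

section Separability
open Set Filter Function CantorScheme
open scoped ENNReal

/-- Splitting step of the perfect-set argument. -/
lemma bb_split {X : Type*} [MetricSpace X] [SecondCountableTopology X] {h : X → ℝ}
    (hh : Continuous h) {V : Set X} (hV : IsOpen V) (hbig : ¬ (h '' V).Countable)
    {ε : ℝ≥0∞} (hε : 0 < ε) :
    ∃ V₀ V₁ : Set X, (IsOpen V₀ ∧ ¬ (h '' V₀).Countable ∧ closure V₀ ⊆ V ∧ Metric.ediam V₀ ≤ ε) ∧
      (IsOpen V₁ ∧ ¬ (h '' V₁).Countable ∧ closure V₁ ⊆ V ∧ Metric.ediam V₁ ≤ ε) ∧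
      Disjoint (h '' V₀) (h '' V₁) := by
  set W : Set X := {x | x ∈ V ∧ ∀ N : Set X, IsOpen N → x ∈ N → ¬ (h '' N).Countable} with hW
  -- the rest has countable image
  have hrest : (h '' (V \ W)).Countable := by
    have : ∀ x ∈ V \ W, ∃ N : Set X, IsOpen N ∧ x ∈ N ∧ (h '' N).Countable := by
      rintro x ⟨hxV, hxW⟩
      by_contra hcon
      push Not at hcon
      exact hxW ⟨hxV, hcon⟩
    choose! N hNo hNx hNc using this
    obtain ⟨t, htsub, htc, hcov⟩ := TopologicalSpace.countable_cover_nhdsWithin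
      (s := V \ W) (f := N) (fun x hx => mem_nhdsWithin_of_mem_nhds ((hNo x hx).mem_nhds (hNx x hx)))
    refine ((htc.biUnion fun x hx => hNc x (htsub hx))).mono ?_
    rintro _ ⟨x, hx, rfl⟩
    obtain ⟨i, hi, hxi⟩ := mem_iUnion₂.1 (hcov hx)
    exact mem_iUnion₂.2 ⟨i, hi, mem_image_of_mem _ hxi⟩
  have hWbig : ¬ (h '' W).Countable := by
    intro hc
    apply hbig
    refine (hc.union hrest).mono ?_
    rintro _ ⟨x, hx, rfl⟩
    by_cases hxW : x ∈ W
    · exact Or.inl ⟨x, hxW, rfl⟩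
    · exact Or.inr ⟨x, ⟨hx, hxW⟩, rfl⟩
  have hnt : (h '' W).Nontrivial := by
    by_contra hcon
    exact hWbig (Set.not_nontrivial_iff.1 hcon).countable
  obtain ⟨_, ⟨x, hx, rfl⟩, _, ⟨y, hy, rfl⟩, hxy⟩ := hnt
  obtain ⟨P, Q, hP, hQ, hxP, hyQ, hPQ⟩ := t2_separation hxy
  have key : ∀ z ∈ W, ∀ P : Set ℝ, IsOpen P → h z ∈ P →
      ∃ V₀ : Set X, (IsOpen V₀ ∧ ¬ (h '' V₀).Countable ∧ closure V₀ ⊆ V ∧ Metric.ediam V₀ ≤ ε) ∧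
        h '' V₀ ⊆ P := by
    intro z hz P hP hzP
    have hmem : V ∩ h ⁻¹' P ∈ nhds z := (hV.inter (hP.preimage hh)).mem_nhds ⟨hz.1, hzP⟩
    obtain ⟨r, hr, hrs⟩ := Metric.nhds_basis_closedBall.mem_iff.1 hmem
    refine ⟨Metric.ball z r ∩ Metric.eball z (ε / 2), ⟨Metric.isOpen_ball.inter Metric.isOpen_eball,
      ?_, ?_, ?_⟩, ?_⟩
    · apply hz.2 _ (Metric.isOpen_ball.inter Metric.isOpen_eball)
      exact ⟨Metric.mem_ball_self hr, Metric.mem_eball_self (ENNReal.half_pos hε.ne')⟩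
    · refine (closure_mono inter_subset_left).trans ?_
      exact (Metric.closure_ball_subset_closedBall).trans (hrs.trans inter_subset_left)
    · refine (Metric.ediam_mono inter_subset_right).trans ?_
      refine Metric.ediam_eball_le.trans ?_
      rw [mul_comm, ENNReal.div_mul_cancel] <;> norm_num
    · rintro _ ⟨w, hw, rfl⟩
      exact (hrs (Metric.ball_subset_closedBall hw.1)).2
  obtain ⟨V₀, h0, h0'⟩ := key x hx P hP hxP
  obtain ⟨V₁, h1, h1'⟩ := key y hy Q hQ hyQ
  exact ⟨V₀, V₁, h0, h1, hPQ.mono h0' h1'⟩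

/-- Perfect set theorem for continuous images of Polish spaces. -/
lemma bb_perfect {X : Type*} [TopologicalSpace X] [PolishSpace X] {h : X → ℝ}
    (hh : Continuous h) (hbig : ¬ (range h).Countable) :
    ∃ ψ : (ℕ → Bool) → X, Injective (h ∘ ψ) := by
  let := TopologicalSpace.upgradeIsCompletelyMetrizable X
  obtain ⟨u, -, upos', hu⟩ := exists_seq_strictAnti_tendsto' (zero_lt_one' ℝ≥0∞)
  have upos := fun n => (upos' n).1
  let P := Subtype fun E : Set X => IsOpen E ∧ ¬ (h '' E).Countable
  choose C0 C1 h0 h1 hdisj using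
    fun {C : Set X} (hC : IsOpen C) (hn : ¬ (h '' C).Countable) {ε : ℝ≥0∞} (hε : 0 < ε) =>
    bb_split hh hC hn hε
  let DP : List Bool → P := fun l => by
    induction l with
    | nil => exact ⟨univ, ⟨isOpen_univ, by rwa [image_univ]⟩⟩
    | cons a l ih =>
      cases a
      · use C0 ih.property.1 ih.property.2 (upos (l.length + 1))
        exact ⟨(h0 _ _ _).1, (h0 _ _ _).2.1⟩
      use C1 ih.property.1 ih.property.2 (upos (l.length + 1))
      exact ⟨(h1 _ _ _).1, (h1 _ _ _).2.1⟩
  let D : List Bool → Set X := fun l => (DP l).val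
  have hanti : ClosureAntitone D := by
    intro l a
    cases a
    · exact (h0 _ _ _).2.2.1
    exact (h1 _ _ _).2.2.1
  have hdiam : VanishingDiam D := by
    intro x
    apply tendsto_of_tendsto_of_tendsto_of_le_of_le' tendsto_const_nhds hu
    · simp
    rw [eventually_atTop]
    refine ⟨1, fun m (hm : 1 ≤ m) => ?_⟩
    rw [Nat.one_le_iff_ne_zero] at hm
    rcases Nat.exists_eq_succ_of_ne_zero hm with ⟨n, rfl⟩
    dsimp
    cases x n
    · convert! (h0 _ _ _).2.2.2
      rw [PiNat.res_length]
    convert! (h1 _ _ _).2.2.2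
    rw [PiNat.res_length]
  have hdisj' : ∀ l : List Bool, Pairwise fun a b => Disjoint (h '' D (a :: l)) (h '' D (b :: l)) := by
    rintro l (a | a) (b | b) hab <;> try contradiction
    · exact hdisj _ _ _
    exact (hdisj _ _ _).symm
  have hdom : ∀ {x : ℕ → Bool}, x ∈ (inducedMap D).1 := fun {x} => by
    rw [hanti.map_of_vanishingDiam hdiam fun l => ?_]
    · apply mem_univ
    · by_contra hcon
      rw [not_nonempty_iff_eq_empty] at hcon
      apply (DP l).property.2
      have : (DP l).val = ∅ := hcon
      rw [this]; simp
  refine ⟨fun x => (inducedMap D).2 ⟨x, hdom⟩, ?_⟩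
  intro x y hxy
  simp only [comp_apply] at hxy
  apply PiNat.res_injective
  ext n : 1
  induction n with
  | zero => simp
  | succ n ih =>
    simp only [PiNat.res_succ, List.cons.injEq]
    refine ⟨?_, ih⟩
    by_contra hne
    have hd := Set.disjoint_left.1 (hdisj' (PiNat.res x n) hne)
    refine @hd (h ((inducedMap D).2 ⟨x, hdom⟩)) ⟨_, ?_, rfl⟩ ?_
    · rw [← PiNat.res_succ]
      exact map_mem (A := D) ⟨x, hdom⟩ (n + 1)
    · rw [hxy, ih, ← PiNat.res_succ]
      exact ⟨_, map_mem (A := D) ⟨y, hdom⟩ (n + 1), rfl⟩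

/-- A real function all of whose preimages are Borel has countable range. -/
lemma bb_countable_range {h : ℝ → ℝ} (hm : ∀ A : Set ℝ, MeasurableSet (h ⁻¹' A)) :
    (range h).Countable := by
  by_contra hbig
  have hmeas : Measurable h := fun A _ => hm A
  -- counting
  have hcard : Cardinal.mk {t : Set ℝ | MeasurableSet t} ≤ Cardinal.continuum := by
    have := MeasurableSpace.cardinal_measurableSet_le_continuum
      (s := MeasurableSpace.countableGeneratingSet ℝ)
      (((MeasurableSpace.countable_countableGeneratingSet (α := ℝ)).le_aleph0).trans
        Cardinal.aleph0_le_continuum)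
    rw [MeasurableSpace.generateFrom_countableGeneratingSet] at this
    exact this
  obtain ⟨t', -, hcont, hpol⟩ := hmeas.exists_continuous
  obtain ⟨ψ, hψ⟩ := @bb_perfect ℝ t' hpol h hcont hbig
  let F : Set (ℕ → Bool) → {t : Set ℝ | MeasurableSet t} :=
    fun A => ⟨h ⁻¹' ((h ∘ ψ) '' A), hm _⟩
  have hF : Injective F := by
    intro A A' hAA
    have h1 : h ⁻¹' ((h ∘ ψ) '' A) = h ⁻¹' ((h ∘ ψ) '' A') := congrArg Subtype.val hAA
    have h2 : ∀ A : Set (ℕ → Bool), ψ ⁻¹' (h ⁻¹' ((h ∘ ψ) '' A)) = A := by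
      intro A
      rw [← preimage_comp]
      exact preimage_image_eq A hψ
    rw [← h2 A, h1, h2 A']
  have h3 := (Cardinal.mk_le_of_injective hF).trans hcard
  have h4 : Cardinal.mk (Set (ℕ → Bool)) = 2 ^ Cardinal.continuum := by
    rw [Cardinal.mk_set]; simp
  rw [h4] at h3
  exact absurd (Cardinal.cantor Cardinal.continuum) (not_lt.2 h3)

/-- A Borel function on the line with values in a metric space has separable range. -/
lemma bb_separable {Y : Type*} [MetricSpace Y] [MeasurableSpace Y] [BorelSpace Y]
    {f : ℝ → Y} (hf : Measurable f) : TopologicalSpace.IsSeparable (range f) := by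
  suffices hsuff : ∀ ε > 0, ∃ t : Set Y, t.Countable ∧ range f ⊆ ⋃ x ∈ t, Metric.closedEBall x ε by
    obtain ⟨t, -, htc, hts⟩ := EMetric.subset_countable_closure_of_almost_dense_set (range f) hsuff
    exact ⟨t, htc, hts⟩
  intro ε hε
  obtain ⟨r, hr, hrε⟩ : ∃ r : ℝ, 0 < r ∧ ENNReal.ofReal r ≤ ε := by
    rcases eq_or_ne ε ⊤ with rfl | hne
    · exact ⟨1, one_pos, le_top⟩
    · exact ⟨ε.toReal, ENNReal.toReal_pos hε.ne' hne, ENNReal.ofReal_toReal_le⟩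
  obtain ⟨D, hDmax⟩ := zorn_subset {N : Set Y | N ⊆ range f ∧ N.Pairwise fun x y => r ≤ dist x y} (by
    intro c hc hchain
    refine ⟨⋃₀ c, ⟨sUnion_subset fun s hs => (hc hs).1, ?_⟩, fun s hs => subset_sUnion_of_mem hs⟩
    exact (pairwise_sUnion hchain.directedOn).2 fun s hs => (hc hs).2)
  have hDr := hDmax.prop.1
  have hDp := hDmax.prop.2
  refine ⟨D, ?_, ?_⟩
  · -- countability
    choose! s hs using fun y (hy : y ∈ D) => hDr hy
    classical
    let h : ℝ → ℝ := fun x => if f x ∈ D then s (f x) else 0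
    have hclosed : ∀ A ⊆ D, IsClosed A := fun A hA =>
      Metric.isClosed_of_pairwise_le_dist hr (hDp.mono hA)
    have hm : ∀ A : Set ℝ, MeasurableSet (h ⁻¹' A) := by
      intro A
      have : h ⁻¹' A = f ⁻¹' (D ∩ s ⁻¹' A) ∪ (f ⁻¹' Dᶜ ∩ {_x | (0 : ℝ) ∈ A}) := by
        ext x
        by_cases hx : f x ∈ D <;> simp [h, hx]
      rw [this]
      exact (hf (hclosed _ inter_subset_left).measurableSet).union
        ((hf (hclosed _ subset_rfl).measurableSet.compl).inter (MeasurableSet.const _))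
    have hinj : InjOn s D := fun a ha b hb hab => by rw [← hs a ha, ← hs b hb, hab]
    have hc := bb_countable_range hm
    have : (s '' D).Countable := by
      refine hc.mono ?_
      rintro _ ⟨y, hy, rfl⟩
      refine ⟨s y, ?_⟩
      simp only [h]
      rw [hs y hy, if_pos hy]
    exact countable_of_injective_of_countable_image hinj this
  · intro y hy
    by_contra hcon
    have hfar : ∀ x ∈ D, r ≤ dist y x := by
      intro x hx
      by_contra hlt
      apply hcon
      refine mem_iUnion₂.2 ⟨x, hx, ?_⟩
      rw [Metric.mem_closedEBall, edist_dist]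
      exact (ENNReal.ofReal_le_ofReal (not_le.1 hlt).le).trans hrε
    have hins : insert y D ∈ {N : Set Y | N ⊆ range f ∧ N.Pairwise fun x y => r ≤ dist x y} := by
      refine ⟨insert_subset hy hDr, hDp.insert fun b hb _ => ⟨hfar b hb, ?_⟩⟩
      rw [dist_comm]; exact hfar b hb
    have hyD : y ∈ D := hDmax.le_of_ge hins (subset_insert y D) (mem_insert y D)
    have := hfar y hyD
    rw [dist_self] at this
    linarith

lemma bb_stronglyMeasurable {Y : Type*} [MetricSpace Y] [MeasurableSpace Y] [BorelSpace Y]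
    {f : ℝ → Y} (hf : Measurable f) : StronglyMeasurable f :=
  stronglyMeasurable_iff_measurable_separable.2 ⟨hf, bb_separable hf⟩

end Separability

section Main
open Set

variable {H : Type*} [NormedAddCommGroup H] [InnerProductSpace ℝ H]

/-- Joint continuity of the semigroup (extended by the identity to negative times). -/
lemma bb_joint_cont (G : ℝ → H →L[ℝ] H)
    (hGcontr : ∀ t : ℝ, 0 ≤ t → ∀ x : H, ‖G t x‖ ≤ ‖x‖)
    (hGcont : ∀ x : H, ContinuousOn (fun t => G t x) (Set.Ici (0 : ℝ))) :
    Continuous fun p : ℝ × H => G (max p.1 0) p.2 := by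
  refine continuous_iff_continuousAt.2 ?_
  rintro ⟨t₀, x₀⟩
  have h1 : Continuous fun p : ℝ × H => G (max p.1 0) x₀ := by
    have : Continuous fun t : ℝ => G (max t 0) x₀ := by
      have := (hGcont x₀).comp_continuous (f := fun t : ℝ => max t 0) (by fun_prop)
        (fun t => mem_Ici.2 (le_max_right _ _))
      exact this
    exact this.comp continuous_fst
  rw [ContinuousAt, tendsto_iff_norm_sub_tendsto_zero]
  have h2 : Filter.Tendsto (fun p : ℝ × H => ‖p.2 - x₀‖ + ‖G (max p.1 0) x₀ - G (max t₀ 0) x₀‖)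
      (nhds (t₀, x₀)) (nhds 0) := by
    have h3 : Continuous (fun p : ℝ × H => ‖p.2 - x₀‖ + ‖G (max p.1 0) x₀ - G (max t₀ 0) x₀‖) := by
      exact ((continuous_snd.sub continuous_const).norm).add ((h1.sub continuous_const).norm)
    have := h3.tendsto (t₀, x₀)
    simpa using this
  refine squeeze_zero (fun _ => norm_nonneg _) (fun p => ?_) h2
  have : G (max p.1 0) p.2 - G (max t₀ 0) x₀
      = G (max p.1 0) (p.2 - x₀) + (G (max p.1 0) x₀ - G (max t₀ 0) x₀) := by
    rw [map_sub]; abel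
  rw [this]
  refine (norm_add_le _ _).trans ?_
  gcongr
  exact hGcontr _ (le_max_right _ _) _

/-- Integrability of the Duhamel integrand. -/
lemma bb_integrable (G : ℝ → H →L[ℝ] H)
    (hGcontr : ∀ t : ℝ, 0 ≤ t → ∀ x : H, ‖G t x‖ ≤ ‖x‖)
    (hGcont : ∀ x : H, ContinuousOn (fun t => G t x) (Set.Ici (0 : ℝ)))
    {w : ℝ → H} (hw : StronglyMeasurable w) {M : ℝ}
    (hM : ∀ᵐ t ∂(volume.restrict (Set.Ici (0 : ℝ))), ‖w t‖ ≤ M)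
    {a b T : ℝ} (ha : 0 ≤ a) (hb : b ≤ T) :
    IntegrableOn (fun s => G (T - s) (w s)) (Ioc a b) := by
  have hsm : StronglyMeasurable fun s => G (max (T - s) 0) (w s) :=
    (bb_joint_cont G hGcontr hGcont).comp_stronglyMeasurable
      (StronglyMeasurable.prodMk (f := fun s : ℝ => T - s)
        (by fun_prop : Continuous fun s : ℝ => T - s).stronglyMeasurable hw)
  have hM' : ∀ᵐ t ∂(volume.restrict (Ioc a b)), ‖w t‖ ≤ M :=
    ae_restrict_of_ae_restrict_of_subset (fun s hs => ha.trans hs.1.le) hM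
  have heq : (fun s => G (max (T - s) 0) (w s)) =ᵐ[volume.restrict (Ioc a b)]
      fun s => G (T - s) (w s) := by
    filter_upwards [ae_restrict_mem measurableSet_Ioc] with s hs
    rw [max_eq_left (by linarith [hs.2])]
  refine Integrable.congr ?_ heq
  refine Integrable.mono' (g := fun _ => M) (integrable_const M) hsm.aestronglyMeasurable ?_
  filter_upwards [hM'] with s hs
  exact (hGcontr _ (le_max_right _ _) _).trans hs

/-- Norm bound of the Duhamel integral. -/
lemma bb_norm_le (G : ℝ → H →L[ℝ] H)
    (hGcontr : ∀ t : ℝ, 0 ≤ t → ∀ x : H, ‖G t x‖ ≤ ‖x‖)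
    {w : ℝ → H} {M : ℝ}
    (hM : ∀ᵐ t ∂(volume.restrict (Set.Ici (0 : ℝ))), ‖w t‖ ≤ M)
    {T : ℝ} (hT : 0 ≤ T) :
    ‖∫ s in Ioc 0 T, G (T - s) (w s)‖ ≤ M * T := by
  have hM' : ∀ᵐ t ∂(volume.restrict (Ioc 0 T)), ‖G (T - t) (w t)‖ ≤ M := by
    filter_upwards [ae_restrict_of_ae_restrict_of_subset
      (fun s (hs : s ∈ Ioc 0 T) => hs.1.le) hM, ae_restrict_mem measurableSet_Ioc] with s hs hs'
    exact (hGcontr _ (by linarith [hs'.2]) _).trans hs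
  have := norm_setIntegral_le_of_norm_le_const_ae (μ := volume) (s := Ioc 0 T) (by simp)
    hM'
  simpa [Measure.real, hT] using this

/-- Dynamic programming: splitting the trajectory at time `δ`. -/
lemma bb_split_time [CompleteSpace H] (G : ℝ → H →L[ℝ] H)
    (hGadd : ∀ s t : ℝ, 0 ≤ s → 0 ≤ t → G (s + t) = (G s).comp (G t))
    (hGcontr : ∀ t : ℝ, 0 ≤ t → ∀ x : H, ‖G t x‖ ≤ ‖x‖)
    (hGcont : ∀ x : H, ContinuousOn (fun t => G t x) (Set.Ici (0 : ℝ)))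
    {w : ℝ → H} (hw : StronglyMeasurable w) {M : ℝ}
    (hM : ∀ᵐ t ∂(volume.restrict (Set.Ici (0 : ℝ))), ‖w t‖ ≤ M)
    {T δ : ℝ} (hδ : 0 ≤ δ) (hδT : δ ≤ T) :
    ∫ s in Ioc 0 T, G (T - s) (w s) = G (T - δ) (∫ s in Ioc 0 δ, G (δ - s) (w s))
      + ∫ s in Ioc 0 (T - δ), G (T - δ - s) (w (s + δ)) := by
  have hu : Ioc 0 T = Ioc 0 δ ∪ Ioc δ T := (Ioc_union_Ioc_eq_Ioc hδ hδT).symm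
  rw [hu, setIntegral_union (Ioc_disjoint_Ioc_of_le le_rfl) measurableSet_Ioc
    (bb_integrable G hGcontr hGcont hw hM le_rfl hδT)
    (bb_integrable G hGcontr hGcont hw hM hδ le_rfl)]
  congr 1
  · rw [← ContinuousLinearMap.integral_comp_comm _
      (bb_integrable G hGcontr hGcont hw hM le_rfl le_rfl)]
    refine setIntegral_congr_fun measurableSet_Ioc fun s hs => ?_
    have : T - s = (T - δ) + (δ - s) := by ring
    show G (T - s) (w s) = _
    rw [this, hGadd _ _ (by linarith) (by linarith [hs.2])]
    rfl
  · rw [← intervalIntegral.integral_of_le hδT, ← intervalIntegral.integral_of_le (by linarith)]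
    have := intervalIntegral.integral_comp_add_right (a := 0) (b := T - δ)
      (fun s => G (T - s) (w s)) δ
    simp only [zero_add, sub_add_cancel] at this
    rw [← this]
    refine intervalIntegral.integral_congr fun s _ => ?_
    show G (T - (s + δ)) (w (s + δ)) = G (T - δ - s) (w (s + δ))
    congr 2
    ring

/-- Small-time continuity of the trajectory. -/
lemma bb_small (G : ℝ → H →L[ℝ] H)
    (hG0 : G 0 = ContinuousLinearMap.id ℝ H)
    (hGcontr : ∀ t : ℝ, 0 ≤ t → ∀ x : H, ‖G t x‖ ≤ ‖x‖)
    (hGcont : ∀ x : H, ContinuousOn (fun t => G t x) (Set.Ici (0 : ℝ)))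
    {w : ℝ → H} {M : ℝ}
    (hM : ∀ᵐ t ∂(volume.restrict (Set.Ici (0 : ℝ))), ‖w t‖ ≤ M) (y₀ : H)
    {δ₀ η : ℝ} (hδ₀ : 0 < δ₀) (hη : 0 < η) :
    ∃ δ, 0 < δ ∧ δ ≤ δ₀ ∧ ‖y₀ - (G δ y₀ + ∫ s in Ioc 0 δ, G (δ - s) (w s))‖ < η := by
  have h1 : Filter.Tendsto (fun δ : ℝ => ‖y₀ - G δ y₀‖ + M * δ) (nhdsWithin 0 (Ioi 0)) (nhds 0) := by
    have h2 : ContinuousWithinAt (fun δ : ℝ => ‖y₀ - G δ y₀‖ + M * δ) (Ici 0) 0 := by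
      have := hGcont y₀ 0 self_mem_Ici
      exact ((continuousWithinAt_const.sub this).norm).add (by fun_prop)
    have h3 := (h2.mono Ioi_subset_Ici_self).tendsto
    simpa [hG0] using h3
  have h4 := (h1.eventually (gt_mem_nhds hη)).and (Ioc_mem_nhdsGT hδ₀)
  obtain ⟨δ, hlt, hδ⟩ := h4.exists
  refine ⟨δ, hδ.1, hδ.2, lt_of_le_of_lt ?_ hlt⟩
  rw [← sub_sub]
  refine (norm_sub_le _ _).trans ?_
  gcongr
  exact bb_norm_le G hGcontr hM hδ.1.le

end Main

/-- Bang-bang principle (Theorem 3.1, second part): if moreover B is idempotent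
and maps U into U, then B(u*(t)) lies on the boundary of U for a.e. t ∈ [0, T*]. -/
theorem bang_bang_principle_truncated
    {H : Type*} [NormedAddCommGroup H] [InnerProductSpace ℝ H] [CompleteSpace H]
    [MeasurableSpace H] [BorelSpace H]
    (G : ℝ → H →L[ℝ] H)
    (hG0 : G 0 = ContinuousLinearMap.id ℝ H)
    (hGadd : ∀ s t : ℝ, 0 ≤ s → 0 ≤ t → G (s + t) = (G s).comp (G t))
    (hGcontr : ∀ t : ℝ, 0 ≤ t → ∀ x : H, ‖G t x‖ ≤ ‖x‖)
    (hGcont : ∀ x : H, ContinuousOn (fun t => G t x) (Set.Ici (0 : ℝ)))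
    (B : H →L[ℝ] H) (hB : ∀ x, ‖B x‖ ≤ ‖x‖)
    (hB_idem : ∀ x : H, B (B x) = B x)
    -- the null controllability property (C):
    (hC : ∀ T : ℝ, 0 < T → ∀ E : Set ℝ, MeasurableSet E → E ⊆ Set.Icc 0 T →
      0 < volume E →
      ∃ δ₀ L : ℝ, 0 < δ₀ ∧ δ₀ < T ∧ 0 < L ∧
        ∀ δ : ℝ, 0 ≤ δ → δ ≤ δ₀ → ∀ z₀ : H,
          ∃ u : ℝ → H, Measurable u ∧
            (∀ᵐ t ∂(volume.restrict (Set.Ici (0 : ℝ))), ‖u t‖ ^ 2 ≤ L * ‖z₀‖ ^ 2) ∧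
            G (T - δ) z₀ + ∫ s in Set.Ioc (0 : ℝ) (T - δ),
                G (T - δ - s)
                  ((Set.indicator {t : ℝ | t + δ ∈ E} (fun _ => (1 : ℝ)) s) • B (u s)) = 0)
    (y₀ : H) (S : Set H) (hS : S.Nonempty)
    (U : Set H) (hU_closed : IsClosed U) (hU_bdd : Bornology.IsBounded U)
    (hU_ne : U.Nonempty)
    (hBU : ∀ v ∈ U, B v ∈ U)
    (Tstar : ℝ) (hTstar : 0 < Tstar)
    (ustar : ℝ → H) (hustar_meas : Measurable ustar)
    (hustar_ad : ∀ᵐ t ∂(volume.restrict (Set.Ici (0 : ℝ))), ustar t ∈ U)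
    -- optimality of (T*, u*):
    (hreach : G Tstar y₀ + ∫ s in Set.Ioc (0 : ℝ) Tstar, G (Tstar - s) (B (ustar s)) ∈ S)
    (hopt : ∀ u : ℝ → H, Measurable u →
      (∀ᵐ t ∂(volume.restrict (Set.Ici (0 : ℝ))), u t ∈ U) →
      ∀ t : ℝ, 0 ≤ t → t < Tstar →
        G t y₀ + ∫ s in Set.Ioc (0 : ℝ) t, G (t - s) (B (u s)) ∉ S) :
    ∀ᵐ t ∂(volume.restrict (Set.Icc (0 : ℝ) Tstar)), B (ustar t) ∈ frontier U := by
  -- bounds and strong measurability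
  obtain ⟨M, hMU⟩ := hU_bdd.exists_norm_le
  have hshift : ∀ δ : ℝ, 0 ≤ δ → ∀ᵐ t ∂(volume.restrict (Set.Ici (0 : ℝ))), ustar (t + δ) ∈ U := by
    intro δ hδ
    rw [ae_restrict_iff' measurableSet_Ici] at hustar_ad ⊢
    have := (measurePreserving_add_right (volume : Measure ℝ) δ).quasiMeasurePreserving.ae hustar_ad
    filter_upwards [this] with t ht ht0
    exact ht (add_nonneg ht0 hδ)
  have hBus : StronglyMeasurable fun t => B (ustar t) :=
    B.continuous.comp_stronglyMeasurable (bb_stronglyMeasurable hustar_meas)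
  have hBuM : ∀ᵐ t ∂(volume.restrict (Set.Ici (0 : ℝ))), ‖B (ustar t)‖ ≤ M := by
    filter_upwards [hustar_ad] with t ht
    exact hMU _ (hBU _ ht)
  -- the crucial claim
  have key : ∀ r : ℝ, 0 < r → volume (Set.Icc 0 Tstar ∩
      (fun t => B (ustar t)) ⁻¹' (Metric.thickening r Uᶜ)ᶜ) = 0 := by
    intro r hr
    by_contra hpos
    set E : Set ℝ := Set.Icc 0 Tstar ∩ (fun t => B (ustar t)) ⁻¹' (Metric.thickening r Uᶜ)ᶜ with hE
    have hEmeas : MeasurableSet E :=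
      measurableSet_Icc.inter (hBus.measurable Metric.isOpen_thickening.measurableSet.compl)
    obtain ⟨δ₀, L, hδ₀, hδ₀T, hL, hctrl⟩ := hC Tstar hTstar E hEmeas Set.inter_subset_left
      (pos_iff_ne_zero.2 hpos)
    obtain ⟨δ, hδ, hδδ₀, hsmall⟩ := bb_small G hG0 hGcontr hGcont hBuM y₀ hδ₀
      (η := r / (Real.sqrt L)) (div_pos hr (Real.sqrt_pos.2 hL))
    set yδ : H := G δ y₀ + ∫ s in Set.Ioc 0 δ, G (δ - s) (B (ustar s)) with hyδ
    obtain ⟨u, humeas, hubd, hueq⟩ := hctrl δ hδ.le hδδ₀ (y₀ - yδ)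
    have hubd' : ∀ᵐ t ∂(volume.restrict (Set.Ici (0 : ℝ))), ‖u t‖ < r := by
      filter_upwards [hubd] with t ht
      have h1 : Real.sqrt L * ‖y₀ - yδ‖ < r := by
        rw [lt_div_iff₀ (Real.sqrt_pos.2 hL)] at hsmall
        linarith
      have h2 : ‖u t‖ ≤ Real.sqrt L * ‖y₀ - yδ‖ := by
        refine (sq_le_sq₀ (norm_nonneg _) (by positivity)).1 ?_
        rw [mul_pow, Real.sq_sqrt hL.le]
        exact ht
      linarith
    set c : ℝ → H := fun s =>
      (Set.indicator {t : ℝ | t + δ ∈ E} (fun _ => (1 : ℝ)) s) • B (u s) with hc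
    have hind : Measurable (Set.indicator {t : ℝ | t + δ ∈ E} (fun _ => (1 : ℝ))) :=
      measurable_const.indicator ((measurable_add_const δ) hEmeas)
    have hcs : StronglyMeasurable c :=
      hind.stronglyMeasurable.smul
        (B.continuous.comp_stronglyMeasurable (bb_stronglyMeasurable humeas))
    have hcM : ∀ᵐ t ∂(volume.restrict (Set.Ici (0 : ℝ))), ‖c t‖ ≤ r := by
      filter_upwards [hubd'] with t ht
      by_cases h : t + δ ∈ E
      · simp only [hc]
        rw [Set.indicator_of_mem (show t ∈ {t : ℝ | t + δ ∈ E} from h), one_smul]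
        exact (hB _).trans ht.le
      · simp only [hc]
        rw [Set.indicator_of_notMem (show t ∉ {t : ℝ | t + δ ∈ E} from h), zero_smul, norm_zero]
        exact hr.le
    have hws : StronglyMeasurable fun s => B (ustar (s + δ)) :=
      hBus.comp_measurable (measurable_add_const δ)
    have hwM : ∀ᵐ t ∂(volume.restrict (Set.Ici (0 : ℝ))), ‖B (ustar (t + δ))‖ ≤ M := by
      filter_upwards [hshift δ hδ.le] with t ht
      exact hMU _ (hBU _ ht)
    -- the new control
    have hvad : ∀ᵐ t ∂(volume.restrict (Set.Ici (0 : ℝ))), B (ustar (t + δ)) + c t ∈ U := by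
      filter_upwards [hshift δ hδ.le, hubd'] with t ht hut
      by_cases h : t + δ ∈ E
      · simp only [hc]
        rw [Set.indicator_of_mem (show t ∈ {t : ℝ | t + δ ∈ E} from h), one_smul]
        by_contra hnot
        apply h.2
        refine Metric.mem_thickening_iff.2 ⟨_, hnot, ?_⟩
        rw [dist_eq_norm, sub_add_cancel_left, norm_neg]
        exact (hB _).trans_lt hut
      · simp only [hc]
        rw [Set.indicator_of_notMem (show t ∉ {t : ℝ | t + δ ∈ E} from h), zero_smul, add_zero]
        exact hBU _ ht
    refine hopt (fun s => B (ustar (s + δ)) + c s) (hws.add hcs).measurable hvad (Tstar - δ)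
      (by linarith) (by linarith) ?_
    convert hreach using 1
    have hBv : ∀ s, B (B (ustar (s + δ)) + c s) = B (ustar (s + δ)) + c s := by
      intro s
      simp only [hc]
      rw [map_add, hB_idem, map_smul, hB_idem]
    simp only [hBv, map_add]
    rw [integral_add (bb_integrable G hGcontr hGcont hws hwM le_rfl le_rfl)
      (bb_integrable G hGcontr hGcont hcs hcM le_rfl le_rfl)]
    rw [bb_split_time G hGadd hGcontr hGcont hBus hBuM hδ.le (by linarith : δ ≤ Tstar)]
    have hsg : G Tstar y₀ = G (Tstar - δ) (G δ y₀) := by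
      have : Tstar = (Tstar - δ) + δ := by ring
      conv_lhs => rw [this, hGadd _ _ (by linarith) hδ.le]
      rfl
    rw [hsg, ← add_assoc (G (Tstar - δ) (G δ y₀)), ← map_add, ← hyδ]
    rw [map_sub] at hueq
    have h5 : ∫ s in Set.Ioc 0 (Tstar - δ), G (Tstar - δ - s) (c s)
        = G (Tstar - δ) yδ - G (Tstar - δ) y₀ := by
      rw [eq_sub_iff_add_eq, ← sub_eq_zero, ← hueq]
      abel
    rw [h5]
    abel
  -- conclusion
  have hall : ∀ᵐ t ∂(volume.restrict (Set.Icc (0 : ℝ) Tstar)), ∀ n : ℕ,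
      B (ustar t) ∈ Metric.thickening (1 / ((n : ℝ) + 1)) Uᶜ := by
    rw [ae_all_iff]
    intro n
    rw [ae_restrict_iff' measurableSet_Icc, ae_iff]
    refine measure_mono_null ?_ (key (1 / ((n : ℝ) + 1)) (by positivity))
    intro t ht
    simp only [Set.mem_ofPred_eq, Classical.not_imp] at ht
    exact ht
  have had : ∀ᵐ t ∂(volume.restrict (Set.Icc (0 : ℝ) Tstar)), ustar t ∈ U :=
    ae_restrict_of_ae_restrict_of_subset Set.Icc_subset_Ici_self hustar_ad
  filter_upwards [hall, had] with t ht htU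
  rw [hU_closed.frontier_eq]
  refine ⟨hBU _ htU, fun hint => ?_⟩
  obtain ⟨ε, hε, hball⟩ := Metric.mem_nhds_iff.1 (mem_interior_iff_mem_nhds.1 hint)
  obtain ⟨n, hn⟩ := exists_nat_one_div_lt hε
  obtain ⟨z, hz, hdz⟩ := Metric.mem_thickening_iff.1 (ht n)
  apply hz
  apply hball
  rw [Metric.mem_ball, dist_comm]
  exact hdz.trans hn
end

section
/- Assume the null controllability property (C). Let U be the closed ball of radius R > 0 centered at some v₀ ∈ H, let S ⊆ H be nonempty and convex, let y₀ ∈ H and T* > 0, and suppose u* ∈ U_ad and v* ∈ U_ad are both optimal (that is, y(T*; u*, y₀) ∈ S, y(T*; v*, y₀) ∈ S, and y(t; u, y₀) ∉ S for every u ∈ U_ad and every t ∈ [0, T*)). Then u*(t) = v*(t) for almost every t ∈ [0, T*]. (Uniqueness of the time optimal control when the target is convex and the control set is a closed ball.) -/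
open MeasureTheory

/-- An uncountable set of reals meets two disjoint closed sets in uncountable sets. -/
theorem toc_exists_condensation {A : Set ℝ} (hA : ¬ A.Countable) :
    ∃ y ∈ A, ∀ V ∈ nhds y, ¬ (A ∩ V).Countable := by
  by_contra! hcon
  choose! V hV hVc using hcon
  obtain ⟨t, htA, htc, ht⟩ := TopologicalSpace.countable_cover_nhdsWithin (s := A) (f := V)
    (fun x hx => nhdsWithin_le_nhds (hV x hx))
  apply hA
  refine (htc.biUnion (fun x hx => hVc x (htA hx))).mono ?_
  intro x hx
  have := ht hx
  simp only [Set.mem_iUnion] at this ⊢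
  obtain ⟨i, hi, hxi⟩ := this
  exact ⟨i, hi, hx, hxi⟩

theorem toc_split_real {A : Set ℝ} (hA : ¬ A.Countable) :
    ∃ I J : Set ℝ, IsClosed I ∧ IsClosed J ∧ Disjoint I J ∧
      ¬ (A ∩ I).Countable ∧ ¬ (A ∩ J).Countable := by
  obtain ⟨y, hyA, hy⟩ := toc_exists_condensation hA
  have hA' : ¬ (A \ {y}).Countable := by
    intro h
    apply hA
    refine (h.union (Set.countable_singleton y)).mono ?_
    intro x hx
    by_cases hxy : x = y
    · right; exact hxy
    · left; exact ⟨hx, hxy⟩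
  obtain ⟨z, hzA, hz⟩ := toc_exists_condensation hA'
  have hne : z ≠ y := hzA.2
  have hd : 0 < dist z y := dist_pos.2 hne
  refine ⟨Metric.closedBall y (dist z y / 3), Metric.closedBall z (dist z y / 3),
    Metric.isClosed_closedBall, Metric.isClosed_closedBall, ?_, ?_, ?_⟩
  · apply Metric.closedBall_disjoint_closedBall
    rw [dist_comm y z]; linarith
  · exact hy _ (Metric.closedBall_mem_nhds _ (by linarith))
  · intro h
    exact hz _ (Metric.closedBall_mem_nhds _ (by linarith))
      (h.mono (Set.inter_subset_inter_left _ Set.sdiff_subset))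

theorem toc_shrink {X : Type*} [MetricSpace X] [SecondCountableTopology X] {h : X → ℝ}
    {C : Set X} (hC : IsClosed C) (hu : ¬ (h '' C).Countable) {ε : ENNReal} (hε : 0 < ε) :
    ∃ C' : Set X, IsClosed C' ∧ C' ⊆ C ∧ ¬ (h '' C').Countable ∧ Metric.ediam C' ≤ ε := by
  by_contra! hcon
  have hε2 : 0 < ε / 2 := ENNReal.half_pos hε.ne'
  obtain ⟨t, htc, ht⟩ := TopologicalSpace.countable_cover_nhds (α := X)
    (f := fun x => Metric.closedEBall x (ε / 2))
    (fun x => Metric.closedEBall_mem_nhds x hε2)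
  apply hu
  have hc : ∀ x, (h '' (C ∩ Metric.closedEBall x (ε / 2))).Countable := by
    intro x
    by_contra hx
    refine absurd ?_ (not_le.2 (hcon _ (hC.inter Metric.isClosed_closedEBall)
      Set.inter_subset_left hx))
    refine (Metric.ediam_mono Set.inter_subset_right).trans ?_
    refine Metric.ediam_closedEBall_le.trans ?_
    rw [ENNReal.mul_div_cancel (by norm_num) (by norm_num)]
  refine (htc.biUnion (fun x _ => hc x)).mono ?_
  rintro _ ⟨x, hx, rfl⟩
  have : x ∈ ⋃ x ∈ t, Metric.closedEBall x (ε / 2) := by rw [ht]; trivial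
  simp only [Set.mem_iUnion] at this ⊢
  obtain ⟨i, hi, hxi⟩ := this
  exact ⟨i, hi, x, ⟨hx, hxi⟩, rfl⟩

theorem toc_splitting {X : Type*} [MetricSpace X] [SecondCountableTopology X] {h : X → ℝ}
    (hh : Continuous h) {C : Set X} (hP : IsClosed C ∧ ¬ (h '' C).Countable)
    {ε : ENNReal} (hε : 0 < ε) :
    ∃ C₀ C₁ : Set X, ((IsClosed C₀ ∧ ¬ (h '' C₀).Countable) ∧ C₀ ⊆ C ∧ Metric.ediam C₀ ≤ ε) ∧
      ((IsClosed C₁ ∧ ¬ (h '' C₁).Countable) ∧ C₁ ⊆ C ∧ Metric.ediam C₁ ≤ ε) ∧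
      Disjoint (h '' C₀) (h '' C₁) := by
  obtain ⟨hC, hu⟩ := hP
  obtain ⟨I, J, hI, hJ, hIJ, hIu, hJu⟩ := toc_split_real hu
  have e : ∀ K : Set ℝ, h '' C ∩ K = h '' (C ∩ h ⁻¹' K) := fun K => by
    rw [Set.image_inter_preimage]
  rw [e] at hIu hJu
  obtain ⟨C₀, h1, h2, h3, h4⟩ := toc_shrink (hC.inter (hI.preimage hh)) hIu hε
  obtain ⟨C₁, k1, k2, k3, k4⟩ := toc_shrink (hC.inter (hJ.preimage hh)) hJu hε
  refine ⟨C₀, C₁, ⟨⟨h1, h3⟩, h2.trans Set.inter_subset_left, h4⟩,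
    ⟨⟨k1, k3⟩, k2.trans Set.inter_subset_left, k4⟩, ?_⟩
  refine hIJ.mono ?_ ?_
  · rintro _ ⟨x, hx, rfl⟩; exact (h2 hx).2
  · rintro _ ⟨x, hx, rfl⟩; exact (k2 hx).2

open CantorScheme PiNat in
theorem toc_cantor {X : Type*} [MetricSpace X] [SecondCountableTopology X] [CompleteSpace X]
    {h : X → ℝ} (hh : Continuous h) (hu : ¬ (Set.range h).Countable) :
    ∃ j : (ℕ → Bool) → X, Function.Injective (h ∘ j) := by
  obtain ⟨u, -, upos', hu0⟩ := exists_seq_strictAnti_tendsto' (zero_lt_one' ENNReal)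
  have upos := fun n => (upos' n).1
  let P := Subtype fun E : Set X => IsClosed E ∧ ¬ (h '' E).Countable
  choose C0 C1 h0 h1 hdisj using
    fun {C : Set X} (hC : IsClosed C ∧ ¬ (h '' C).Countable) {ε : ENNReal} (hε : 0 < ε) =>
    toc_splitting hh hC hε
  let DP : List Bool → P := fun l => by
    induction l with
    | nil => exact ⟨Set.univ, isClosed_univ, by rwa [Set.image_univ]⟩
    | cons a l ih =>
      cases a
      · exact ⟨C0 ih.property (upos (l.length + 1)), (h0 _ _).1⟩
      · exact ⟨C1 ih.property (upos (l.length + 1)), (h1 _ _).1⟩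
  let D : List Bool → Set X := fun l => (DP l).val
  have hanti : ClosureAntitone D := by
    refine Antitone.closureAntitone ?_ fun l => (DP l).property.1
    intro l a
    cases a
    · exact (h0 _ _).2.1
    exact (h1 _ _).2.1
  have hdiam : VanishingDiam D := by
    intro x
    apply tendsto_of_tendsto_of_tendsto_of_le_of_le' tendsto_const_nhds hu0
    · simp
    rw [Filter.eventually_atTop]
    refine ⟨1, fun m (hm : 1 ≤ m) => ?_⟩
    rw [Nat.one_le_iff_ne_zero] at hm
    rcases Nat.exists_eq_succ_of_ne_zero hm with ⟨n, rfl⟩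
    dsimp
    cases x n
    · convert! (h0 _ _).2.2
      rw [PiNat.res_length]
    convert! (h1 _ _).2.2
    rw [PiNat.res_length]
  have hdisj' : CantorScheme.Disjoint (fun l => h '' D l) := by
    rintro l (a | a) (b | b) hab <;> try contradiction
    · exact hdisj _ _
    exact (hdisj _ _).symm
  have hne : ∀ l, (D l).Nonempty := by
    intro l
    by_contra hcon
    rw [Set.not_nonempty_iff_eq_empty] at hcon
    apply (DP l).property.2
    have : (DP l).val = ∅ := hcon
    rw [this]; simp
  have hdom : ∀ {x : ℕ → Bool}, x ∈ (inducedMap D).1 := fun {x} => by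
    rw [hanti.map_of_vanishingDiam hdiam hne]
    apply Set.mem_univ
  refine ⟨fun x => (inducedMap D).2 ⟨x, hdom⟩, ?_⟩
  intro x y hxy
  simp only [Function.comp] at hxy
  apply res_injective
  ext n : 1
  induction n with
  | zero => simp
  | succ n ih =>
    simp only [res_succ, List.cons.injEq]
    refine ⟨?_, ih⟩
    by_contra hne'
    have hd := hdisj' (res x n) hne'
    have hl := Set.disjoint_left.1 hd
    refine @hl (h ((inducedMap D).2 ⟨x, hdom⟩)) ?_ ?_
    · exact ⟨_, map_mem (A := D) ⟨x, hdom⟩ (n + 1), rfl⟩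
    · rw [hxy, ih]
      exact ⟨_, map_mem (A := D) ⟨y, hdom⟩ (n + 1), rfl⟩

theorem toc_cantor_polish {X : Type*} [TopologicalSpace X] [PolishSpace X]
    {h : X → ℝ} (hh : Continuous h) (hu : ¬ (Set.range h).Countable) :
    ∃ j : (ℕ → Bool) → X, Function.Injective (h ∘ j) := by
  let := TopologicalSpace.upgradeIsCompletelyMetrizable X
  exact toc_cantor hh hu

/-- A function on the reals all of whose preimages are Borel has countable range. -/
theorem toc_countable_range {h : ℝ → ℝ} (hh : ∀ A : Set ℝ, MeasurableSet (h ⁻¹' A)) :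
    (Set.range h).Countable := by
  by_contra hu
  have hm : Measurable h := fun A _ => hh A
  obtain ⟨j, hj⟩ : ∃ j : (ℕ → Bool) → ℝ, Function.Injective (h ∘ j) := by
    obtain ⟨t', -, hc, hpol⟩ := hm.exists_continuous
    exact @toc_cantor_polish ℝ t' hpol h hc hu
  let Φ : Set (ℕ → Bool) → {t : Set ℝ | MeasurableSet t} :=
    fun A => ⟨h ⁻¹' ((h ∘ j) '' A), hh _⟩
  have hΦ : Function.Injective Φ := by
    intro A A' hAA
    have h1 : h ⁻¹' ((h ∘ j) '' A) = h ⁻¹' ((h ∘ j) '' A') := congrArg Subtype.val hAA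
    have h2 := congrArg (fun s => j ⁻¹' s) h1
    simp only [← Set.preimage_comp] at h2
    rwa [Set.preimage_image_eq _ hj, Set.preimage_image_eq _ hj] at h2
  have h1 := Cardinal.mk_le_of_injective hΦ
  have h2 : Cardinal.mk {t : Set ℝ | MeasurableSet t} ≤ Cardinal.continuum := by
    have := MeasurableSpace.cardinal_measurableSet_le_continuum
      (s := (⋃ a : ℚ, {Set.Iio (a : ℝ)})) (by
        refine le_trans ?_ Cardinal.aleph0_le_continuum
        rw [Cardinal.mk_le_aleph0_iff]
        exact (Set.countable_iUnion fun a => Set.countable_singleton _).to_subtype)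
    rw [← Real.borel_eq_generateFrom_Iio_rat] at this
    rwa [← BorelSpace.measurable_eq (α := ℝ)] at this
  have h3 : Cardinal.mk (Set (ℕ → Bool)) = 2 ^ Cardinal.continuum := by
    simp
  rw [h3] at h1
  exact absurd (h1.trans h2) (not_le.2 (Cardinal.cantor _))

theorem toc_stronglyMeasurable {H : Type*} [MetricSpace H] [MeasurableSpace H] [BorelSpace H]
    {f : ℝ → H} (hf : Measurable f) : StronglyMeasurable f := by
  classical
  refine stronglyMeasurable_iff_measurable_separable.2 ⟨hf, ?_⟩
  suffices hs : ∀ ε > 0, ∃ t : Set H, t.Countable ∧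
      Set.range f ⊆ ⋃ x ∈ t, Metric.closedEBall x ε by
    obtain ⟨t, -, h2, h3⟩ := EMetric.subset_countable_closure_of_almost_dense_set _ hs
    exact ⟨t, h2, h3⟩
  intro ε' hε'
  obtain ⟨ε, hε, hεε⟩ := ENNReal.lt_iff_exists_nnreal_btwn.1 hε'
  have hε0 : 0 < (ε : ℝ) := by exact_mod_cast hε
  obtain ⟨D, hD⟩ := zorn_subset {N : Set H | N ⊆ Set.range f ∧ Metric.IsSeparated ε N} (by
    intro c hc hchain
    refine ⟨⋃₀ c, ⟨Set.sUnion_subset fun s hs => (hc hs).1, ?_⟩,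
      fun s hs => Set.subset_sUnion_of_mem hs⟩
    exact (Set.pairwise_sUnion hchain.directedOn).2 fun s hs => (hc hs).2)
  have hcov := Metric.IsCover.of_maximal_isSeparated hD
  refine ⟨D, ?_, ?_⟩
  swap
  · intro x hx
    obtain ⟨y, hy, hxy⟩ := hcov hx
    simp only [Set.mem_iUnion]
    exact ⟨y, hy, le_trans hxy hεε.le⟩
  have hDm : ∀ A ⊆ D, MeasurableSet A := by
    intro A hA
    refine IsClosed.measurableSet (Metric.isClosed_of_pairwise_le_dist hε0 ?_)
    intro x hx y hy hxy
    have : (ε : ENNReal) < edist x y := hD.1.2 (hA hx) (hA hy) hxy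
    rw [edist_nndist] at this
    have h2 : ε < nndist x y := by exact_mod_cast this
    exact_mod_cast h2.le
  have hsec : ∀ x ∈ D, ∃ t, f t = x := fun x hx => hD.1.1 hx
  choose! σ hσ using hsec
  let g : H → ℝ := fun x => if x ∈ D then σ x else 0
  have hg : ∀ A : Set ℝ, MeasurableSet (g ⁻¹' A) := by
    intro A
    have e : g ⁻¹' A = (D ∩ σ ⁻¹' A) ∪ (Dᶜ ∩ {x | (0 : ℝ) ∈ A}) := by
      ext x
      by_cases hx : x ∈ D <;> simp [g, hx]
    rw [e]
    refine (hDm _ Set.inter_subset_left).union ?_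
    exact (hDm D subset_rfl).compl.inter (MeasurableSet.const _)
  have hr := toc_countable_range (h := g ∘ f) (fun A => by
    rw [Set.preimage_comp]; exact hf (hg A))
  have hDs : Set.InjOn g D := by
    intro x hx y hy hxy
    simp only [g, hx, hy, if_true] at hxy
    rw [← hσ x hx, ← hσ y hy, hxy]
  refine Set.countable_of_injective_of_countable_image hDs (hr.mono ?_)
  rintro _ ⟨x, hx, rfl⟩
  exact ⟨σ x, by simp [hσ x hx]⟩

theorem toc_joint_cont {H : Type*} [NormedAddCommGroup H] [InnerProductSpace ℝ H]
    (G : ℝ → H →L[ℝ] H)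
    (hGcontr : ∀ t : ℝ, 0 ≤ t → ∀ x : H, ‖G t x‖ ≤ ‖x‖)
    (hGcont : ∀ x : H, ContinuousOn (fun t => G t x) (Set.Ici (0 : ℝ))) :
    Continuous (fun p : ℝ × H => G (max p.1 0) p.2) := by
  rw [continuous_iff_continuousAt]
  rintro ⟨t0, x0⟩
  have h1 : Continuous (fun t : ℝ => G (max t 0) x0) :=
    (hGcont x0).comp_continuous (by fun_prop) (fun t => Set.mem_Ici.2 (le_max_right _ _))
  rw [ContinuousAt, tendsto_iff_norm_sub_tendsto_zero]
  have h2 : Continuous (fun p : ℝ × H => ‖p.2 - x0‖ + ‖G (max p.1 0) x0 - G (max t0 0) x0‖) := by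
    have := h1.comp (continuous_fst (X := ℝ) (Y := H))
    exact ((continuous_snd.sub continuous_const).norm).add ((this.sub continuous_const).norm)
  have h3 := h2.tendsto (t0, x0)
  simp only [sub_self, norm_zero, add_zero] at h3
  refine squeeze_zero (fun _ => norm_nonneg _) (fun p => ?_) h3
  have e : G (max p.1 0) p.2 - G (max t0 0) x0
      = G (max p.1 0) (p.2 - x0) + (G (max p.1 0) x0 - G (max t0 0) x0) := by
    rw [map_sub]; abel
  simp only [e]
  exact (norm_add_le _ _).trans (by gcongr; exact hGcontr _ (le_max_right _ _) _)

theorem toc_integrableOn {H : Type*} [NormedAddCommGroup H] [InnerProductSpace ℝ H]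
    (G : ℝ → H →L[ℝ] H)
    (hGcontr : ∀ t : ℝ, 0 ≤ t → ∀ x : H, ‖G t x‖ ≤ ‖x‖)
    (hGcont : ∀ x : H, ContinuousOn (fun t => G t x) (Set.Ici (0 : ℝ)))
    (B : H →L[ℝ] H) (hB : ∀ x, ‖B x‖ ≤ ‖x‖) {f : ℝ → H} (hf : StronglyMeasurable f)
    {M : ℝ} (hM : ∀ᵐ t ∂(volume.restrict (Set.Ici (0 : ℝ))), ‖f t‖ ≤ M)
    {a b T : ℝ} (ha : 0 ≤ a) (hb : b ≤ T) :
    (∀ᵐ s ∂(volume.restrict (Set.Ioc a b)), ‖G (T - s) (B (f s))‖ ≤ M) ∧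
    IntegrableOn (fun s => G (T - s) (B (f s))) (Set.Ioc a b) := by
  have hbd : ∀ᵐ s ∂(volume.restrict (Set.Ioc a b)), ‖G (T - s) (B (f s))‖ ≤ M := by
    have h1 : ∀ᵐ t ∂(volume.restrict (Set.Ioc a b)), ‖f t‖ ≤ M :=
      ae_restrict_of_ae_restrict_of_subset (fun s hs => ha.trans hs.1.le) hM
    filter_upwards [h1, ae_restrict_mem measurableSet_Ioc] with s hs hs'
    exact (hGcontr _ (by linarith [hs'.2]) _).trans ((hB _).trans hs)
  refine ⟨hbd, ?_⟩
  refine Integrable.of_bound ?_ M hbd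
  have hsm : StronglyMeasurable (fun s => G (max (T - s) 0) (B (f s))) := by
    refine (toc_joint_cont G hGcontr hGcont).comp_stronglyMeasurable
      (f := fun s => (T - s, B (f s))) ?_
    refine StronglyMeasurable.prodMk ?_ (B.continuous.comp_stronglyMeasurable hf)
    exact (by fun_prop : Continuous fun s : ℝ => T - s).stronglyMeasurable
  refine hsm.aestronglyMeasurable.congr ?_
  filter_upwards [ae_restrict_mem measurableSet_Ioc] with s hs
  rw [max_eq_left (by linarith [hs.2])]

/-- Theorem 3.4: uniqueness of the time optimal control when the target set is
convex and the control set is a closed ball. -/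
theorem time_optimal_control_unique
    {H : Type*} [NormedAddCommGroup H] [InnerProductSpace ℝ H] [CompleteSpace H]
    [MeasurableSpace H] [BorelSpace H]
    (G : ℝ → H →L[ℝ] H)
    (hG0 : G 0 = ContinuousLinearMap.id ℝ H)
    (hGadd : ∀ s t : ℝ, 0 ≤ s → 0 ≤ t → G (s + t) = (G s).comp (G t))
    (hGcontr : ∀ t : ℝ, 0 ≤ t → ∀ x : H, ‖G t x‖ ≤ ‖x‖)
    (hGcont : ∀ x : H, ContinuousOn (fun t => G t x) (Set.Ici (0 : ℝ)))
    (B : H →L[ℝ] H) (hB : ∀ x, ‖B x‖ ≤ ‖x‖)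
    -- the null controllability property (C):
    (hC : ∀ T : ℝ, 0 < T → ∀ E : Set ℝ, MeasurableSet E → E ⊆ Set.Icc 0 T →
      0 < volume E →
      ∃ δ₀ L : ℝ, 0 < δ₀ ∧ δ₀ < T ∧ 0 < L ∧
        ∀ δ : ℝ, 0 ≤ δ → δ ≤ δ₀ → ∀ z₀ : H,
          ∃ u : ℝ → H, Measurable u ∧
            (∀ᵐ t ∂(volume.restrict (Set.Ici (0 : ℝ))), ‖u t‖ ^ 2 ≤ L * ‖z₀‖ ^ 2) ∧
            G (T - δ) z₀ + ∫ s in Set.Ioc (0 : ℝ) (T - δ),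
                G (T - δ - s)
                  ((Set.indicator {t : ℝ | t + δ ∈ E} (fun _ => (1 : ℝ)) s) • B (u s)) = 0)
    (y₀ : H) (S : Set H) (hS_ne : S.Nonempty) (hS_conv : Convex ℝ S)
    (v₀ : H) (R : ℝ) (hR : 0 < R) (U : Set H) (hU : U = Metric.closedBall v₀ R)
    (Tstar : ℝ) (hTstar : 0 < Tstar)
    (ustar vstar : ℝ → H)
    (hustar_meas : Measurable ustar) (hvstar_meas : Measurable vstar)
    (hustar_ad : ∀ᵐ t ∂(volume.restrict (Set.Ici (0 : ℝ))), ustar t ∈ U)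
    (hvstar_ad : ∀ᵐ t ∂(volume.restrict (Set.Ici (0 : ℝ))), vstar t ∈ U)
    -- both controls are optimal:
    (hreach_u : G Tstar y₀ + ∫ s in Set.Ioc (0 : ℝ) Tstar, G (Tstar - s) (B (ustar s)) ∈ S)
    (hreach_v : G Tstar y₀ + ∫ s in Set.Ioc (0 : ℝ) Tstar, G (Tstar - s) (B (vstar s)) ∈ S)
    (hopt : ∀ u : ℝ → H, Measurable u →
      (∀ᵐ t ∂(volume.restrict (Set.Ici (0 : ℝ))), u t ∈ U) →
      ∀ t : ℝ, 0 ≤ t → t < Tstar →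
        G t y₀ + ∫ s in Set.Ioc (0 : ℝ) t, G (t - s) (B (u s)) ∉ S) :
    ∀ᵐ t ∂(volume.restrict (Set.Icc (0 : ℝ) Tstar)), ustar t = vstar t := by
  classical
  subst hU
  have hu := toc_stronglyMeasurable hustar_meas
  have hv := toc_stronglyMeasurable hvstar_meas
  set M : ℝ := ‖v₀‖ + R with hMdef
  have hball : ∀ x ∈ Metric.closedBall v₀ R, ‖x‖ ≤ M := by
    intro x hx
    rw [mem_closedBall_iff_norm] at hx
    have := norm_add_le (x - v₀) v₀
    rw [sub_add_cancel] at this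
    linarith
  have hM0 : 0 ≤ M := by positivity
  have huM : ∀ᵐ t ∂(volume.restrict (Set.Ici (0 : ℝ))), ‖ustar t‖ ≤ M := by
    filter_upwards [hustar_ad] with t ht using hball _ ht
  have hvM : ∀ᵐ t ∂(volume.restrict (Set.Ici (0 : ℝ))), ‖vstar t‖ ≤ M := by
    filter_upwards [hvstar_ad] with t ht using hball _ ht
  -- the averaged control
  let w : ℝ → H := fun t => (1 / 2 : ℝ) • ustar t + (1 / 2 : ℝ) • vstar t
  have hw : StronglyMeasurable w := (hu.const_smul _).add (hv.const_smul _)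
  have hw_ad : ∀ᵐ t ∂(volume.restrict (Set.Ici (0 : ℝ))), w t ∈ Metric.closedBall v₀ R := by
    filter_upwards [hustar_ad, hvstar_ad] with t h1 h2
    exact convex_closedBall v₀ R h1 h2 (by norm_num) (by norm_num) (by norm_num)
  have hwM : ∀ᵐ t ∂(volume.restrict (Set.Ici (0 : ℝ))), ‖w t‖ ≤ M := by
    filter_upwards [hw_ad] with t ht using hball _ ht
  have hreach_w : G Tstar y₀ + ∫ s in Set.Ioc (0 : ℝ) Tstar, G (Tstar - s) (B (w s)) ∈ S := by
    have hiu := (toc_integrableOn G hGcontr hGcont B hB hu huM le_rfl (le_refl Tstar)).2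
    have hiv := (toc_integrableOn G hGcontr hGcont B hB hv hvM le_rfl (le_refl Tstar)).2
    have := hS_conv hreach_u hreach_v (by norm_num : (0 : ℝ) ≤ 1 / 2)
      (by norm_num : (0 : ℝ) ≤ 1 / 2) (by norm_num)
    convert this using 1
    have e : ∫ s in Set.Ioc (0 : ℝ) Tstar, G (Tstar - s) (B (w s))
        = (1 / 2 : ℝ) • (∫ s in Set.Ioc (0 : ℝ) Tstar, G (Tstar - s) (B (ustar s)))
          + (1 / 2 : ℝ) • (∫ s in Set.Ioc (0 : ℝ) Tstar, G (Tstar - s) (B (vstar s))) := by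
      rw [← integral_smul, ← integral_smul]
      refine Eq.trans ?_ (integral_add (hiu.smul (1 / 2 : ℝ)) (hiv.smul (1 / 2 : ℝ)))
      simp [w]
    rw [e]
    module
  by_contra hcon
  -- a set of positive measure where the average is uniformly interior
  obtain ⟨n, hn⟩ : ∃ n : ℕ, 0 < volume
      {t : ℝ | t ∈ Set.Icc 0 Tstar ∧ ‖w t - v₀‖ ≤ R - 1 / ((n : ℝ) + 1)} := by
    by_contra! hzero
    apply hcon
    have hz : ∀ᵐ t ∂(volume : Measure ℝ), ∀ n : ℕ,
        ¬ (t ∈ Set.Icc 0 Tstar ∧ ‖w t - v₀‖ ≤ R - 1 / ((n : ℝ) + 1)) := by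
      rw [ae_all_iff]
      intro n
      rw [ae_iff]
      simpa only [not_not] using le_antisymm (hzero n) zero_le
    rw [ae_restrict_iff' measurableSet_Ici] at hustar_ad hvstar_ad
    rw [ae_restrict_iff' measurableSet_Icc]
    filter_upwards [hz, hustar_ad, hvstar_ad] with t h1 h2 h3 ht
    by_contra hne
    have h2 := h2 ht.1
    have h3 := h3 ht.1
    rw [mem_closedBall_iff_norm] at h2 h3
    have hlt : ‖w t - v₀‖ < R := by
      have := norm_combo_lt_of_ne h2 h3 (fun h => hne (sub_left_injective h))
        (by norm_num : (0 : ℝ) < 1 / 2) (by norm_num : (0 : ℝ) < 1 / 2) (by norm_num)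
      convert this using 2
      simp only [w]
      module
    obtain ⟨n, hn⟩ := exists_nat_one_div_lt (sub_pos.2 hlt)
    exact h1 n ⟨ht, by linarith⟩
  set ε : ℝ := 1 / ((n : ℝ) + 1) with hε
  have hε0 : 0 < ε := by positivity
  set E : Set ℝ := {t : ℝ | t ∈ Set.Icc 0 Tstar ∧ ‖w t - v₀‖ ≤ R - ε} with hE
  have hEm : MeasurableSet E := by
    refine measurableSet_Icc.inter ?_
    exact measurableSet_le (hw.sub stronglyMeasurable_const).norm.measurable measurable_const
  obtain ⟨δ₀, L, hδ₀, hδ₀T, hL, hctrl⟩ := hC Tstar hTstar E hEm (fun t ht => ht.1) hn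
  -- choice of a small time shift
  obtain ⟨δ, hδ0, hδ1, hδ2⟩ : ∃ δ : ℝ, 0 < δ ∧ δ ≤ δ₀ ∧
      Real.sqrt L * (‖G δ y₀ - y₀‖ + M * δ) ≤ ε := by
    have hc : ContinuousOn (fun δ : ℝ => Real.sqrt L * (‖G δ y₀ - y₀‖ + M * δ)) (Set.Ici 0) := by
      have := hGcont y₀
      fun_prop
    have ht := (hc 0 Set.self_mem_Ici).mono Set.Ioi_subset_Ici_self
    have ht' := ht.tendsto
    simp only [hG0, ContinuousLinearMap.id_apply, sub_self, norm_zero, mul_zero, add_zero] at ht'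
    have h1 := ht'.eventually (gt_mem_nhds hε0)
    have h2 : ∀ᶠ δ in nhdsWithin (0 : ℝ) (Set.Ioi 0), δ ∈ Set.Ioo 0 δ₀ := Ioo_mem_nhdsGT hδ₀
    obtain ⟨δ, h3, h4⟩ := (h1.and h2).exists
    exact ⟨δ, h4.1, h4.2.le, h3.le⟩
  have hδT : δ < Tstar := lt_of_le_of_lt hδ1 hδ₀T
  set I₀ : H := ∫ s in Set.Ioc (0 : ℝ) δ, G (δ - s) (B (w s)) with hI₀
  have hI₀n : ‖I₀‖ ≤ M * δ := by
    have h1 := (toc_integrableOn G hGcontr hGcont B hB hw hwM le_rfl (le_refl δ)).1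
    have := norm_setIntegral_le_of_norm_le_const_ae (μ := volume) (s := Set.Ioc (0 : ℝ) δ)
      (by simp) h1
    simpa [hδ0.le] using this
  set z : H := y₀ - (G δ y₀ + I₀) with hz
  have hzn : ‖z‖ ≤ ‖G δ y₀ - y₀‖ + M * δ := by
    have : z = -((G δ y₀ - y₀) + I₀) := by rw [hz]; abel
    rw [this, norm_neg]
    exact (norm_add_le _ _).trans (by gcongr)
  obtain ⟨p, hpm, hpb, hp0⟩ := hctrl δ hδ0.le hδ1 z
  have hp := toc_stronglyMeasurable hpm
  have hpb' : ∀ᵐ t ∂(volume.restrict (Set.Ici (0 : ℝ))), ‖p t‖ ≤ ε := by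
    filter_upwards [hpb] with t ht
    have h1 : ‖p t‖ ≤ Real.sqrt L * ‖z‖ := by
      apply abs_le_of_sq_le_sq' _ (by positivity) |>.2
      rw [mul_pow, Real.sq_sqrt hL.le]; exact ht
    exact h1.trans (le_trans (by gcongr) hδ2)
  -- the shifted and corrected control
  let q : ℝ → H := fun s =>
    (Set.indicator {t : ℝ | t + δ ∈ E} (fun _ => (1 : ℝ)) s) • p s
  have hEδm : MeasurableSet {t : ℝ | t + δ ∈ E} := (measurable_add_const δ) hEm
  have hq : StronglyMeasurable q :=
    (stronglyMeasurable_const.indicator hEδm).smul hp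
  let w' : ℝ → H := fun s => w (s + δ)
  have hw' : StronglyMeasurable w' := hw.comp_measurable (measurable_add_const δ)
  have hw'_ad : ∀ᵐ t ∂(volume.restrict (Set.Ici (0 : ℝ))), w' t ∈ Metric.closedBall v₀ R := by
    rw [ae_restrict_iff' measurableSet_Ici] at hw_ad ⊢
    have := (measurePreserving_add_right (volume : Measure ℝ) δ).quasiMeasurePreserving.ae hw_ad
    filter_upwards [this] with t ht ht0
    exact ht (by simp only [Set.mem_Ici] at ht0 ⊢; linarith)
  have hw'M : ∀ᵐ t ∂(volume.restrict (Set.Ici (0 : ℝ))), ‖w' t‖ ≤ M := by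
    filter_upwards [hw'_ad] with t ht using hball _ ht
  have hqM : ∀ᵐ t ∂(volume.restrict (Set.Ici (0 : ℝ))), ‖q t‖ ≤ ε := by
    filter_upwards [hpb'] with t ht
    by_cases h : t + δ ∈ E
    · simpa [q, h] using ht
    · simpa [q, h] using hε0.le
  have hc_ad : ∀ᵐ t ∂(volume.restrict (Set.Ici (0 : ℝ))),
      (w' + q) t ∈ Metric.closedBall v₀ R := by
    filter_upwards [hw'_ad, hpb'] with t h1 h2
    by_cases h : t + δ ∈ E
    · have h3 := h.2
      have : (w' + q) t - v₀ = (w (t + δ) - v₀) + p t := by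
        simp [q, w', h]; abel
      rw [mem_closedBall_iff_norm, this]
      exact (norm_add_le _ _).trans (by linarith)
    · simpa [q, h] using h1
  refine hopt (w' + q) (hw'.add hq).measurable hc_ad (Tstar - δ) (by linarith) (by linarith) ?_
  convert hreach_w using 1
  have hi1 := (toc_integrableOn G hGcontr hGcont B hB hw' hw'M le_rfl (le_refl (Tstar - δ))).2
  have hi2 := (toc_integrableOn G hGcontr hGcont B hB hq hqM le_rfl (le_refl (Tstar - δ))).2
  have e1 : ∫ s in Set.Ioc (0 : ℝ) (Tstar - δ), G (Tstar - δ - s) (B ((w' + q) s))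
      = (∫ s in Set.Ioc (0 : ℝ) (Tstar - δ), G (Tstar - δ - s) (B (w' s)))
        + ∫ s in Set.Ioc (0 : ℝ) (Tstar - δ), G (Tstar - δ - s) (B (q s)) := by
    rw [← integral_add hi1 hi2]
    simp
  have e2 : ∫ s in Set.Ioc (0 : ℝ) (Tstar - δ), G (Tstar - δ - s) (B (q s))
      = - G (Tstar - δ) z := by
    rw [eq_neg_iff_add_eq_zero, add_comm, ← hp0]
    simp [q]
  have e3 : ∫ s in Set.Ioc (0 : ℝ) (Tstar - δ), G (Tstar - δ - s) (B (w' s))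
      = ∫ s in Set.Ioc δ Tstar, G (Tstar - s) (B (w s)) := by
    rw [← intervalIntegral.integral_of_le (by linarith),
      ← intervalIntegral.integral_of_le hδT.le]
    have := intervalIntegral.integral_comp_add_right (a := 0) (b := Tstar - δ)
      (fun s => G (Tstar - s) (B (w s))) δ
    rw [zero_add, sub_add_cancel] at this
    rw [← this]
    congr 1
    ext s
    simp only [w']
    rw [sub_sub, add_comm δ s]
  have e4 : ∫ s in Set.Ioc (0 : ℝ) Tstar, G (Tstar - s) (B (w s))
      = (∫ s in Set.Ioc (0 : ℝ) δ, G (Tstar - s) (B (w s)))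
        + ∫ s in Set.Ioc δ Tstar, G (Tstar - s) (B (w s)) := by
    rw [← setIntegral_union (Set.Ioc_disjoint_Ioc_of_le le_rfl) measurableSet_Ioc
      (toc_integrableOn G hGcontr hGcont B hB hw hwM le_rfl hδT.le).2
      (toc_integrableOn G hGcontr hGcont B hB hw hwM hδ0.le le_rfl).2,
      Set.Ioc_union_Ioc_eq_Ioc hδ0.le hδT.le]
  have e5 : ∫ s in Set.Ioc (0 : ℝ) δ, G (Tstar - s) (B (w s)) = G (Tstar - δ) I₀ := by
    rw [hI₀, ← ContinuousLinearMap.integral_comp_comm _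
      (toc_integrableOn G hGcontr hGcont B hB hw hwM le_rfl (le_refl δ)).2]
    refine setIntegral_congr_fun measurableSet_Ioc (fun s hs => ?_)
    have := hGadd (Tstar - δ) (δ - s) (by linarith) (by linarith [hs.2])
    rw [sub_add_sub_cancel] at this
    simp only [this, ContinuousLinearMap.comp_apply]
  have e6 : G Tstar y₀ = G (Tstar - δ) (G δ y₀) := by
    have := hGadd (Tstar - δ) δ (by linarith) hδ0.le
    rw [sub_add_cancel] at this
    rw [this, ContinuousLinearMap.comp_apply]
  rw [e1, e2, e3, e4, e5, e6, hz, map_sub, map_add]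
  abel
end
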